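/- arXiv:2308.06014 — 7 statements merged into one kernel-verified Lean document; each statement's English description precedes it below -/
import Mathlib

section
/- Let N ≥ 2 be an integer, let α be a real number with (4−N)/2 < α < 2, and let λ > 0. Then the function U_{λ,α}(x) = C_{N,α} λ^{(N−4+2α)/2} (1 + λ^{2−α}|x|^{2−α})^{−(N−4+2α)/(2−α)} satisfies the weighted fourth-order equation div(|x|^α ∇(div(|x|^α ∇U_{λ,α})))(x) = U_{λ,α}(x)^{2**_α − 1} at every point x ∈ ℝ^N \ {0}. -/
open Real MeasureTheory Filter

noncomputable section

/-- Laplacian of a real-valued function on Euclidean space. -/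
def lap {N : ℕ} (u : EuclideanSpace ℝ (Fin N) → ℝ) (x : EuclideanSpace ℝ (Fin N)) : ℝ :=
  ∑ i : Fin N, fderiv ℝ (fun y => fderiv ℝ u y (EuclideanSpace.single i 1)) x
    (EuclideanSpace.single i 1)

/-- The weighted operator `div(|x|^α ∇u)(x) = |x|^α Δu(x) + α |x|^(α-2) (x · ∇u(x))`.
Note that `x · ∇u(x)` is the directional derivative of `u` at `x` along `x`. -/
def wOp {N : ℕ} (α : ℝ) (u : EuclideanSpace ℝ (Fin N) → ℝ) (x : EuclideanSpace ℝ (Fin N)) : ℝ :=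
  ‖x‖ ^ α * lap u x + α * ‖x‖ ^ (α - 2) * fderiv ℝ u x x

/-- The constant `C_{N,α} = [(N−4+2α)(N−2+α)N(N+2−α)]^{(N−4+2α)/(8−4α)}`. -/
def Cconst (N : ℕ) (α : ℝ) : ℝ :=
  (((N : ℝ) - 4 + 2*α) * ((N : ℝ) - 2 + α) * (N : ℝ) * ((N : ℝ) + 2 - α)) ^
    (((N : ℝ) - 4 + 2*α) / (8 - 4*α))

/-- The radial solution `U_{λ,α}(x) = C_{N,α} λ^{(N−4+2α)/2} (1+λ^{2−α}|x|^{2−α})^{−(N−4+2α)/(2−α)}`. -/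
def Usol (N : ℕ) (α lam : ℝ) (x : EuclideanSpace ℝ (Fin N)) : ℝ :=
  Cconst N α * lam ^ (((N : ℝ) - 4 + 2*α)/2) *
    (1 + lam ^ (2-α) * ‖x‖ ^ (2-α)) ^ (-(((N : ℝ) - 4 + 2*α)/(2-α)))

/-- The critical exponent `2**_α = 2N/(N-4+2α)`. -/
def pexp (N : ℕ) (α : ℝ) : ℝ := 2*(N : ℝ)/((N : ℝ) - 4 + 2*α)

/-- The constant `C(M) = (M−4)(M−2)M(M+2)(Γ(M/2)²/(2Γ(M)))^{4/M}`. -/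
def CM (M : ℝ) : ℝ :=
  (M-4)*(M-2)*M*(M+2) * (Real.Gamma (M/2)^2 / (2*Real.Gamma M)) ^ ((4 : ℝ)/M)

/-- The sharp radial constant `S^{rad}_{N,α}`. -/
def Srad (N : ℕ) (α : ℝ) : ℝ :=
  ((2-α)/2) ^ ((4 : ℝ) - (4-2*α)/(N : ℝ)) *
    (2 * Real.pi ^ ((N : ℝ)/2) / Real.Gamma ((N : ℝ)/2)) ^ ((4-2*α)/(N : ℝ)) *
    CM (2*(N : ℝ)/(2-α))

/-- The derivative of a function of the squared norm away from the origin. -/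
theorem hasFDerivAt_of_eq_normSq {N : ℕ} {u : EuclideanSpace ℝ (Fin N) → ℝ} {H H1 : ℝ → ℝ}
    (hu : ∀ y, y ≠ 0 → u y = H (‖y‖ ^ 2))
    (hH : ∀ r, 0 < r → HasDerivAt H (H1 r) r)
    {x : EuclideanSpace ℝ (Fin N)} (hx : x ≠ 0) :
    HasFDerivAt u (H1 (‖x‖ ^ 2) • ((2 : ℝ) • innerSL ℝ x)) x := by
  have h1 : HasFDerivAt (fun y : EuclideanSpace ℝ (Fin N) => ‖y‖ ^ 2)
      ((2 : ℝ) • innerSL ℝ x) x := by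
    rw [ofNat_smul_eq_nsmul ℝ 2]
    exact (hasStrictFDerivAt_norm_sq x).hasFDerivAt
  have hr : 0 < ‖x‖ ^ 2 := by positivity
  refine ((hH _ hr).comp_hasFDerivAt x h1).congr_of_eventuallyEq ?_
  filter_upwards [isOpen_ne.mem_nhds hx] with y hy using hu y hy

/-- The Laplacian of a function of the squared norm away from the origin. -/
theorem lap_of_eq_normSq {N : ℕ} {u : EuclideanSpace ℝ (Fin N) → ℝ} {H H1 H2 : ℝ → ℝ}
    (hu : ∀ y, y ≠ 0 → u y = H (‖y‖ ^ 2))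
    (hH : ∀ r, 0 < r → HasDerivAt H (H1 r) r)
    (hH1 : ∀ r, 0 < r → HasDerivAt H1 (H2 r) r)
    {x : EuclideanSpace ℝ (Fin N)} (hx : x ≠ 0) :
    lap u x = 4 * H2 (‖x‖ ^ 2) * ‖x‖ ^ 2 + 2 * N * H1 (‖x‖ ^ 2) := by
  have key : ∀ i : Fin N, fderiv ℝ (fun y => fderiv ℝ u y (EuclideanSpace.single i 1)) x
      (EuclideanSpace.single i 1) = 4 * H2 (‖x‖ ^ 2) * x i ^ 2 + 2 * H1 (‖x‖ ^ 2) := by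
    intro i
    have hcoord : HasFDerivAt (fun y : EuclideanSpace ℝ (Fin N) => y i)
        (EuclideanSpace.proj i : EuclideanSpace ℝ (Fin N) →L[ℝ] ℝ) x :=
      (EuclideanSpace.proj i : EuclideanSpace ℝ (Fin N) →L[ℝ] ℝ).hasFDerivAt
    have hH1' := hasFDerivAt_of_eq_normSq (u := fun y => H1 (‖y‖ ^ 2)) (fun _ _ => rfl) hH1 hx
    have hprod := (hH1'.mul hcoord).const_mul (2 : ℝ)
    have heq : (fun y => fderiv ℝ u y (EuclideanSpace.single i 1)) =ᶠ[nhds x]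
        fun y => 2 * (H1 (‖y‖ ^ 2) * y i) := by
      filter_upwards [isOpen_ne.mem_nhds hx] with y hy
      rw [(hasFDerivAt_of_eq_normSq hu hH hy).fderiv]
      simp [EuclideanSpace.inner_single_right]
      ring
    rw [(hprod.congr_of_eventuallyEq heq).fderiv]
    simp [EuclideanSpace.inner_single_right]
    ring
  unfold lap
  rw [Finset.sum_congr rfl fun i _ => key i, Finset.sum_add_distrib, ← Finset.mul_sum,
    ← EuclideanSpace.real_norm_sq_eq]
  simp
  ring

/-- The weighted operator acting on a function of the squared norm. -/
theorem wOp_of_eq_normSq {N : ℕ} {u : EuclideanSpace ℝ (Fin N) → ℝ} {H H1 H2 : ℝ → ℝ} (α : ℝ)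
    (hu : ∀ y, y ≠ 0 → u y = H (‖y‖ ^ 2))
    (hH : ∀ r, 0 < r → HasDerivAt H (H1 r) r)
    (hH1 : ∀ r, 0 < r → HasDerivAt H1 (H2 r) r)
    {x : EuclideanSpace ℝ (Fin N)} (hx : x ≠ 0) :
    wOp α u x = ‖x‖ ^ α * (4 * ‖x‖ ^ 2 * H2 (‖x‖ ^ 2) + 2 * (N + α) * H1 (‖x‖ ^ 2)) := by
  have hpos : 0 < ‖x‖ := norm_pos_iff.mpr hx
  have hpow : ‖x‖ ^ (α - 2) * ‖x‖ ^ 2 = ‖x‖ ^ α := by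
    rw [← Real.rpow_natCast ‖x‖ 2, ← Real.rpow_add hpos]
    norm_num
  unfold wOp
  rw [lap_of_eq_normSq hu hH hH1 hx, (hasFDerivAt_of_eq_normSq hu hH hx).fderiv]
  simp only [smul_apply, innerSL_apply_apply, real_inner_self_eq_norm_sq,
    smul_eq_mul]
  linear_combination (2 * α * H1 (‖x‖ ^ 2)) * hpow

/-- In the variable `t = |x|^(2-α)` the weighted operator acts on a radial function `G(t)`, with
derivatives `G1` and `G2`, as `(2-α)² t G2 + (2-α) N G1`. -/
theorem wOp_of_eq_norm_rpow {N : ℕ} {u : EuclideanSpace ℝ (Fin N) → ℝ} {G G1 G2 : ℝ → ℝ} (α : ℝ)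
    (hu : ∀ y, y ≠ 0 → u y = G (‖y‖ ^ (2 - α)))
    (hG : ∀ t, 0 < t → HasDerivAt G (G1 t) t)
    (hG1 : ∀ t, 0 < t → HasDerivAt G1 (G2 t) t)
    {x : EuclideanSpace ℝ (Fin N)} (hx : x ≠ 0) :
    wOp α u x = (2 - α) ^ 2 * ‖x‖ ^ (2 - α) * G2 (‖x‖ ^ (2 - α)) +
      (2 - α) * N * G1 (‖x‖ ^ (2 - α)) := by
  have hsq : ∀ (y : EuclideanSpace ℝ (Fin N)) (c : ℝ), (‖y‖ ^ 2) ^ c = ‖y‖ ^ (2 * c) := by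
    intro y c
    rw [← Real.rpow_natCast ‖y‖ 2, ← Real.rpow_mul (norm_nonneg y)]
    norm_num
  set a : ℝ := (2 - α) / 2 with ha
  have hpow : ∀ (c r : ℝ), 0 < r → HasDerivAt (fun ρ : ℝ => ρ ^ c) (c * r ^ (c - 1)) r :=
    fun c r hr => Real.hasDerivAt_rpow_const (Or.inl hr.ne')
  have hH : ∀ r, 0 < r → HasDerivAt (fun ρ => G (ρ ^ a)) (G1 (r ^ a) * (a * r ^ (a - 1))) r :=
    fun r hr => (hG _ (Real.rpow_pos_of_pos hr a)).comp r (hpow a r hr)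
  have hH1 : ∀ r, 0 < r → HasDerivAt (fun ρ => G1 (ρ ^ a) * (a * ρ ^ (a - 1)))
      (G2 (r ^ a) * (a * r ^ (a - 1)) * (a * r ^ (a - 1)) +
        G1 (r ^ a) * (a * ((a - 1) * r ^ (a - 1 - 1)))) r := fun r hr =>
    ((hG1 _ (Real.rpow_pos_of_pos hr a)).comp r (hpow a r hr)).mul
      ((hpow (a - 1) r hr).const_mul a)
  have hu' : ∀ y, y ≠ 0 → u y = (fun ρ => G (ρ ^ a)) (‖y‖ ^ 2) := by
    intro y hy
    have h2a : 2 * a = 2 - α := by rw [ha]; ring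
    simp only [hsq, h2a]
    exact hu y hy
  have hpos : 0 < ‖x‖ := norm_pos_iff.mpr hx
  rw [wOp_of_eq_normSq α hu' hH hH1 hx]
  have hα : α = 2 - 2 * a := by rw [ha]; ring
  have e1 : (‖x‖ ^ 2) ^ (a - 1) = ‖x‖ ^ (2 * a) / ‖x‖ ^ 2 := by
    rw [hsq, show 2 * (a - 1) = 2 * a - (2 : ℕ) by push_cast; ring, Real.rpow_sub hpos,
      Real.rpow_natCast]
  have e2 : (‖x‖ ^ 2) ^ (a - 1 - 1) = ‖x‖ ^ (2 * a) / ‖x‖ ^ 2 / ‖x‖ ^ 2 := by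
    rw [Real.rpow_sub_one (by positivity), e1]
  have e3 : ‖x‖ ^ α = ‖x‖ ^ 2 / ‖x‖ ^ (2 * a) := by
    rw [hα, show (2 : ℝ) - 2 * a = (2 : ℕ) - 2 * a by norm_num, Real.rpow_sub hpos,
      Real.rpow_natCast]
  have e4 : (2 : ℝ) - α = 2 * a := by rw [ha]; ring
  have hT : 0 < ‖x‖ ^ (2 * a) := Real.rpow_pos_of_pos hpos _
  rw [e1, e2, e3, e4, hsq, hα]
  generalize ‖x‖ ^ (2 * a) = T at *
  field_simp
  ring

/-- The derivative of a power of an affine function with positive coefficients. -/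
theorem hasDerivAt_one_add_mul_rpow {b t : ℝ} (hb : 0 < b) (ht : 0 < t) (c q : ℝ) :
    HasDerivAt (fun t : ℝ => c * (1 + b * t) ^ q) (c * (b * q) * (1 + b * t) ^ (q - 1)) t := by
  have hw : 1 + b * t ≠ 0 := by positivity
  have h1 : HasDerivAt (fun t : ℝ => 1 + b * t) b t := by
    simpa using ((hasDerivAt_id t).const_mul b).const_add 1
  exact ((h1.rpow_const (p := q) (Or.inl hw)).const_mul c).congr_deriv (by ring)

/-- The weighted bilaplacian of `A (1 + b |x|^s)^(-m/s)`, where `s = 2 - α` and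
`m = N - 4 + 2α`. -/
theorem wOp_wOp_bubble {N : ℕ} {α b : ℝ} (hα : α < 2) (hb : 0 < b) (A : ℝ)
    {x : EuclideanSpace ℝ (Fin N)} (hx : x ≠ 0) :
    wOp α (wOp α fun y => A * (1 + b * ‖y‖ ^ (2 - α)) ^ (-(((N : ℝ) - 4 + 2 * α) / (2 - α)))) x =
      (((N : ℝ) - 4 + 2 * α) * ((N : ℝ) - 2 + α) * N * ((N : ℝ) + 2 - α)) * A * b ^ 2 *
        (1 + b * ‖x‖ ^ (2 - α)) ^ (-(((N : ℝ) - 4 + 2 * α) / (2 - α)) - 4) := by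
  have hs : 2 - α ≠ 0 := by linarith
  set m : ℝ := (N : ℝ) - 4 + 2 * α with hm
  set p : ℝ := -(m / (2 - α)) with hp
  have hps : p * (2 - α) = -m := by rw [hp]; field_simp
  have first : ∀ y : EuclideanSpace ℝ (Fin N), y ≠ 0 →
      wOp α (fun y => A * (1 + b * ‖y‖ ^ (2 - α)) ^ p) y =
        (fun t : ℝ => -(A * m * b * (2 - α)) * (1 + b * t) ^ (p - 1) +
          -(A * m * b * (m + (2 - α))) * (1 + b * t) ^ (p - 2)) (‖y‖ ^ (2 - α)) := by
    intro y hy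
    rw [wOp_of_eq_norm_rpow (G := fun t => A * (1 + b * t) ^ p) α (fun _ _ => rfl)
      (fun t ht => hasDerivAt_one_add_mul_rpow hb ht A p)
      (fun t ht => hasDerivAt_one_add_mul_rpow hb ht _ (p - 1)) hy]
    have ht : 0 < ‖y‖ ^ (2 - α) := Real.rpow_pos_of_pos (norm_pos_iff.mpr hy) _
    generalize ‖y‖ ^ (2 - α) = t at *
    have hw : 1 + b * t ≠ 0 := by positivity
    have e1 : (1 + b * t) ^ (p - 1) = (1 + b * t) ^ (p - 2) * (1 + b * t) := by
      rw [← Real.rpow_add_one hw]; ring_nf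
    simp only [show p - 1 - 1 = p - 2 by ring, e1]
    generalize (1 + b * t) ^ (p - 2) = W
    have hN : (N : ℝ) = m + 2 * (2 - α) := by rw [hm]; ring
    rw [hN]
    have hm' : m = -(p * (2 - α)) := by rw [hps]; ring
    rw [hm']
    ring
  rw [wOp_of_eq_norm_rpow α first
    (fun t ht => (hasDerivAt_one_add_mul_rpow hb ht _ (p - 1)).add
      (hasDerivAt_one_add_mul_rpow hb ht _ (p - 2)))
    (fun t ht => (hasDerivAt_one_add_mul_rpow hb ht _ (p - 1 - 1)).add
      (hasDerivAt_one_add_mul_rpow hb ht _ (p - 2 - 1))) hx]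
  have ht : 0 < ‖x‖ ^ (2 - α) := Real.rpow_pos_of_pos (norm_pos_iff.mpr hx) _
  generalize ‖x‖ ^ (2 - α) = t at *
  have hw : 1 + b * t ≠ 0 := by positivity
  have e3 : (1 + b * t) ^ (p - 3) = (1 + b * t) ^ (p - 4) * (1 + b * t) := by
    rw [← Real.rpow_add_one hw]; ring_nf
  have e2 : (1 + b * t) ^ (p - 2) = (1 + b * t) ^ (p - 4) * (1 + b * t) * (1 + b * t) := by
    rw [← e3, ← Real.rpow_add_one hw]; ring_nf
  simp only [show p - 1 - 1 = p - 2 by ring, show p - 2 - 1 = p - 3 by ring,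
    show p - 3 - 1 = p - 4 by ring, e2, e3]
  generalize (1 + b * t) ^ (p - 4) = W
  have hN : (N : ℝ) = m + 2 * (2 - α) := by rw [hm]; ring
  have hm' : m = -(p * (2 - α)) := by rw [hps]; ring
  rw [hN, hm']
  ring

/-- `U_{λ,α}` solves the weighted fourth-order equation
`div(|x|^α ∇(div(|x|^α ∇U))) = U^{2**_α − 1}` on `ℝ^N \ {0}`. -/
theorem stmt0 (N : ℕ) (hN : 2 ≤ N) (α : ℝ) (hα1 : ((4 : ℝ) - N)/2 < α) (hα2 : α < 2)
    (lam : ℝ) (hlam : 0 < lam) :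
    ∀ x : EuclideanSpace ℝ (Fin N), x ≠ 0 →
      wOp α (wOp α (Usol N α lam)) x = (Usol N α lam x) ^ (pexp N α - 1) := by
  intro x hx
  have hb : 0 < lam ^ (2 - α) := Real.rpow_pos_of_pos hlam _
  have hm : 0 < (N : ℝ) - 4 + 2 * α := by linarith
  have hs : 0 < 2 - α := by linarith
  have hN' : 0 < (N : ℝ) := by positivity
  have hK : 0 < ((N : ℝ) - 4 + 2 * α) * ((N : ℝ) - 2 + α) * N * ((N : ℝ) + 2 - α) := by
    have h1 : 0 < (N : ℝ) - 2 + α := by linarith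
    have h2 : 0 < (N : ℝ) + 2 - α := by linarith
    positivity
  have hC : 0 < Cconst N α := Real.rpow_pos_of_pos hK _
  have hL : 0 < lam ^ (((N : ℝ) - 4 + 2 * α) / 2) := Real.rpow_pos_of_pos hlam _
  have hA := mul_pos hC hL
  have ht : 0 < ‖x‖ ^ (2 - α) := Real.rpow_pos_of_pos (norm_pos_iff.mpr hx) _
  have hw : 0 < 1 + lam ^ (2 - α) * ‖x‖ ^ (2 - α) := by positivity
  refine (wOp_wOp_bubble hα2 hb _ hx).trans ?_
  have hexp : pexp N α - 1 = 1 + 4 * (2 - α) / ((N : ℝ) - 4 + 2 * α) := by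
    unfold pexp
    field_simp
    ring
  have hCpow : Cconst N α ^ (4 * (2 - α) / ((N : ℝ) - 4 + 2 * α)) =
      ((N : ℝ) - 4 + 2 * α) * ((N : ℝ) - 2 + α) * N * ((N : ℝ) + 2 - α) := by
    have h8 : (8 : ℝ) - 4 * α ≠ 0 := by linarith
    have he : ((N : ℝ) - 4 + 2 * α) / (8 - 4 * α) * (4 * (2 - α) / ((N : ℝ) - 4 + 2 * α)) = 1 := by
      rw [show (4 : ℝ) * (2 - α) = 8 - 4 * α by ring]
      field_simp
    unfold Cconst
    rw [← Real.rpow_mul hK.le, he, Real.rpow_one]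
  have hLpow : (lam ^ (((N : ℝ) - 4 + 2 * α) / 2)) ^ (4 * (2 - α) / ((N : ℝ) - 4 + 2 * α)) =
      (lam ^ (2 - α)) ^ 2 := by
    rw [← Real.rpow_natCast (lam ^ (2 - α)) 2, ← Real.rpow_mul hlam.le, ← Real.rpow_mul hlam.le]
    congr 1
    push_cast
    field_simp
    ring
  have hwpow : ((1 + lam ^ (2 - α) * ‖x‖ ^ (2 - α)) ^ (-(((N : ℝ) - 4 + 2 * α) / (2 - α)))) ^
      (1 + 4 * (2 - α) / ((N : ℝ) - 4 + 2 * α)) =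
      (1 + lam ^ (2 - α) * ‖x‖ ^ (2 - α)) ^ (-(((N : ℝ) - 4 + 2 * α) / (2 - α)) - 4) := by
    rw [← Real.rpow_mul hw.le]
    congr 1
    field_simp
    ring
  unfold Usol
  rw [hexp, Real.mul_rpow hA.le (Real.rpow_nonneg hw.le _), hwpow, Real.rpow_add hA,
    Real.rpow_one, Real.mul_rpow hC.le hL.le, hCpow, hLpow]
  ring

end
end

section
/- Let N ≥ 2 be an integer and let α be a real number with (4−N)/2 < α < 2. Set κ₁ = (N−4+2α)/2, κ₂ = N/2, K₂ = κ₁² + κ₂², K₀ = κ₁²κ₂², m = −(N−4+2α)/(2−α), ν = (2−α)/2, and 𝒞 = [m(m−1)(m−2)(m−3)ν⁴]^{(N−4+2α)/(8−4α)}. Then the function φ(t) = 𝒞 (cosh(νt))^m is positive and satisfies the fourth-order ordinary differential equation φ''''(t) − K₂ φ''(t) + K₀ φ(t) = φ(t)^{2**_α − 1} for every t ∈ ℝ. -/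
open Real MeasureTheory Filter

noncomputable section

/-- The second derivative of `cosh (ν t) ^ a` is a combination of powers of `cosh (ν t)`. -/
theorem deriv_deriv_cosh_rpow (ν a : ℝ) :
    deriv (deriv fun t : ℝ => Real.cosh (ν * t) ^ a) = fun t =>
      ν ^ 2 * a ^ 2 * Real.cosh (ν * t) ^ a
        - ν ^ 2 * (a * (a - 1)) * Real.cosh (ν * t) ^ (a - 2) := by
  have hlin (t : ℝ) : HasDerivAt (fun t : ℝ => ν * t) ν t := by
    simpa using (hasDerivAt_id t).const_mul ν
  have hrpow (b t : ℝ) : HasDerivAt (fun t : ℝ => Real.cosh (ν * t) ^ b)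
      (Real.sinh (ν * t) * ν * b * Real.cosh (ν * t) ^ (b - 1)) t :=
    (hlin t).cosh.rpow_const (Or.inl (Real.cosh_pos _).ne')
  rw [funext fun t => (hrpow a t).deriv]
  funext t
  have hsinh : HasDerivAt (fun t : ℝ => Real.sinh (ν * t) * ν * a)
      (Real.cosh (ν * t) * ν * ν * a) t :=
    ((hlin t).sinh.mul_const ν).mul_const a
  refine (hsinh.mul (hrpow (a - 1) t)).deriv.trans ?_
  have hc := Real.cosh_pos (ν * t)
  have h₁ : Real.cosh (ν * t) ^ (a - 1) = Real.cosh (ν * t) ^ (a - 2) * Real.cosh (ν * t) := by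
    rw [← Real.rpow_add_one hc.ne']
    ring_nf
  have h₂ : Real.cosh (ν * t) ^ a = Real.cosh (ν * t) ^ (a - 2) * Real.cosh (ν * t) ^ 2 := by
    rw [← Real.rpow_add_natCast hc.ne']
    norm_num
  rw [show a - 1 - 1 = a - 2 by ring, h₁, h₂]
  linear_combination
    ν ^ 2 * a * (a - 1) * Real.cosh (ν * t) ^ (a - 2) * Real.sinh_sq (ν * t)

theorem contDiff_cosh_rpow (ν a : ℝ) {n : WithTop ℕ∞} :
    ContDiff ℝ n fun t : ℝ => Real.cosh (ν * t) ^ a :=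
  (Real.contDiff_cosh.comp (contDiff_const.mul contDiff_id)).rpow_const_of_ne
    fun t => (Real.cosh_pos (ν * t)).ne'

theorem iteratedDeriv_two_cosh_rpow (ν a : ℝ) :
    iteratedDeriv 2 (fun t : ℝ => Real.cosh (ν * t) ^ a) = fun t =>
      ν ^ 2 * a ^ 2 * Real.cosh (ν * t) ^ a
        - ν ^ 2 * (a * (a - 1)) * Real.cosh (ν * t) ^ (a - 2) := by
  rw [iteratedDeriv_succ, iteratedDeriv_one, deriv_deriv_cosh_rpow]

theorem iteratedDeriv_four_cosh_rpow (ν a : ℝ) :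
    iteratedDeriv 4 (fun t : ℝ => Real.cosh (ν * t) ^ a) = fun t =>
      ν ^ 4 * a ^ 4 * Real.cosh (ν * t) ^ a
        - ν ^ 4 * (a * (a - 1)) * (a ^ 2 + (a - 2) ^ 2) * Real.cosh (ν * t) ^ (a - 2)
        + ν ^ 4 * (a * (a - 1) * (a - 2) * (a - 3)) * Real.cosh (ν * t) ^ (a - 4) := by
  funext t
  have hsplit : iteratedDeriv 4 (fun t : ℝ => Real.cosh (ν * t) ^ a)
      = iteratedDeriv 2 (iteratedDeriv 2 fun t : ℝ => Real.cosh (ν * t) ^ a) := by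
    simp only [iteratedDeriv_eq_iterate, ← Function.iterate_add_apply]
  rw [hsplit, iteratedDeriv_two_cosh_rpow,
    iteratedDeriv_fun_sub (contDiff_const.mul (contDiff_cosh_rpow ν a)).contDiffAt
      (contDiff_const.mul (contDiff_cosh_rpow ν (a - 2))).contDiffAt,
    iteratedDeriv_const_mul_field, iteratedDeriv_const_mul_field,
    iteratedDeriv_two_cosh_rpow, iteratedDeriv_two_cosh_rpow, show a - 2 - 2 = a - 4 by ring]
  ring

/-- The operator with characteristic exponents `±ν a` and `±ν (a - 2)` maps `cosh (ν t) ^ a` to a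
multiple of `cosh (ν t) ^ (a - 4)`. -/
theorem fourthOrder_cosh_rpow (C ν a t : ℝ) :
    iteratedDeriv 4 (fun t : ℝ => C * Real.cosh (ν * t) ^ a) t
        - ((ν * a) ^ 2 + (ν * (a - 2)) ^ 2)
          * iteratedDeriv 2 (fun t : ℝ => C * Real.cosh (ν * t) ^ a) t
        + (ν * a) ^ 2 * (ν * (a - 2)) ^ 2 * (C * Real.cosh (ν * t) ^ a)
      = C * (a * (a - 1) * (a - 2) * (a - 3) * ν ^ 4) * Real.cosh (ν * t) ^ (a - 4) := by
  rw [iteratedDeriv_const_mul_field, iteratedDeriv_const_mul_field, iteratedDeriv_four_cosh_rpow,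
    iteratedDeriv_two_cosh_rpow]
  ring

/-- the Emden–Fowler profile `φ(t) = 𝒞 (cosh(νt))^m` is positive and solves the
fourth-order ODE `φ'''' − K₂ φ'' + K₀ φ = φ^{2**_α − 1}` on `ℝ`. -/
theorem stmt1 (N : ℕ) (hN : 2 ≤ N) (α : ℝ) (hα1 : ((4 : ℝ) - N)/2 < α) (hα2 : α < 2) :
    let κ₁ : ℝ := ((N : ℝ) - 4 + 2*α)/2
    let κ₂ : ℝ := (N : ℝ)/2
    let K₂ : ℝ := κ₁^2 + κ₂^2
    let K₀ : ℝ := κ₁^2 * κ₂^2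
    let m : ℝ := -(((N : ℝ) - 4 + 2*α))/(2-α)
    let ν : ℝ := (2-α)/2
    let C : ℝ := (m*(m-1)*(m-2)*(m-3)*ν^4) ^ (((N : ℝ) - 4 + 2*α)/(8 - 4*α))
    let φ : ℝ → ℝ := fun t => C * (Real.cosh (ν*t)) ^ m
    ∀ t : ℝ, 0 < φ t ∧
      iteratedDeriv 4 φ t - K₂ * iteratedDeriv 2 φ t + K₀ * φ t
        = (φ t) ^ (pexp N α - 1) := by
  intro κ₁ κ₂ K₂ K₀ m ν C φ t
  have hd : 0 < (N : ℝ) - 4 + 2 * α := by linarith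
  have hα : 0 < 2 - α := by linarith
  have hm : m < 0 := div_neg_of_neg_of_pos (neg_neg_of_pos hd) hα
  have hA : 0 < m * (m - 1) * (m - 2) * (m - 3) * ν ^ 4 := by
    have hν : 0 < ν := half_pos hα
    have h₁ : 0 < m * (m - 1) := mul_pos_of_neg_of_neg hm (by linarith)
    have h₂ : 0 < (m - 2) * (m - 3) := mul_pos_of_neg_of_neg (by linarith) (by linarith)
    rw [mul_assoc (m * (m - 1))]
    positivity
  have hC : 0 < C := Real.rpow_pos_of_pos hA _
  have hcosh := Real.cosh_pos (ν * t)
  have hκ₁ : (ν * m) ^ 2 = κ₁ ^ 2 := by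
    simp only [ν, m, κ₁]
    field_simp
  have hκ₂ : (ν * (m - 2)) ^ 2 = κ₂ ^ 2 := by
    simp only [ν, m, κ₂]
    field_simp
    ring
  have hexp : m * (pexp N α - 1) = m - 4 := by
    simp only [m, pexp]
    field_simp
    ring
  have hpow : C ^ (pexp N α - 1) = C * (m * (m - 1) * (m - 2) * (m - 3) * ν ^ 4) := by
    have he : ((N : ℝ) - 4 + 2 * α) / (8 - 4 * α) * (pexp N α - 1)
        = ((N : ℝ) - 4 + 2 * α) / (8 - 4 * α) + 1 := by
      have : 8 - 4 * α ≠ 0 := by linarith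
      simp only [pexp]
      field_simp
      ring
    simp only [C]
    rw [← Real.rpow_mul hA.le, he, Real.rpow_add_one hA.ne']
  refine ⟨mul_pos hC (Real.rpow_pos_of_pos hcosh m), ?_⟩
  have hode := fourthOrder_cosh_rpow C ν m t
  rw [hκ₁, hκ₂] at hode
  refine hode.trans ?_
  simp only [φ]
  rw [Real.mul_rpow hC.le (Real.rpow_nonneg hcosh.le m), ← Real.rpow_mul hcosh.le, hexp, hpow]

end
end

section
/- Let N ≥ 2 be an integer and let α be a real number with (4−N)/2 < α < 2. Set κ₁ = (N−4+2α)/2, K₂ = ((N+α−2)² + (2−α)²)/2 and K₀ = N²(N−4+2α)²/16. Let φ : ℝ → ℝ be a C⁴ function and define u : ℝ^N \ {0} → ℝ by u(x) = |x|^{−κ₁} φ(−ln|x|). Then for every x ∈ ℝ^N \ {0}, u satisfies div(|x|^α ∇(div(|x|^α ∇u)))(x) = |u(x)|^{2**_α − 2} u(x) if and only if, at t = −ln|x|, φ satisfies φ''''(t) − K₂ φ''(t) + K₀ φ(t) = |φ(t)|^{2**_α − 2} φ(t). -/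
open Real MeasureTheory Filter

noncomputable section

theorem hasFDerivAt_comp_neg_log_norm {N : ℕ} {G : ℝ → ℝ} {G' : ℝ}
    {x : EuclideanSpace ℝ (Fin N)} (hx : x ≠ 0) (hG : HasDerivAt G G' (-Real.log ‖x‖)) :
    HasFDerivAt (fun y : EuclideanSpace ℝ (Fin N) => G (-Real.log ‖y‖))
      ((-(G' / ‖x‖ ^ 2)) • innerSL ℝ x) x := by
  have hn : ‖x‖ ^ 2 ≠ 0 := pow_ne_zero 2 (norm_ne_zero_iff.mpr hx)
  have h1 : HasFDerivAt (fun y : EuclideanSpace ℝ (Fin N) => ‖y‖ ^ 2)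
      (2 • innerSL ℝ x) x := (hasStrictFDerivAt_norm_sq x).hasFDerivAt
  have h2 := (h1.log hn).const_mul (-(1 / 2 : ℝ))
  have e : ∀ y : EuclideanSpace ℝ (Fin N),
      -(1 / 2 : ℝ) * Real.log (‖y‖ ^ 2) = -Real.log ‖y‖ := by
    intro y
    rw [Real.log_pow]
    push_cast
    ring
  simp only [e] at h2
  refine (hG.comp_hasFDerivAt x h2).congr_fderiv ?_
  ext v
  simp
  ring

/-- The weighted operator acting on a radial function, in the variable `t = -log |x|`. -/
theorem wOp_comp_neg_log_norm {N : ℕ} (α : ℝ) {G G' : ℝ → ℝ} {G'' : ℝ}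
    {x : EuclideanSpace ℝ (Fin N)} (hx : x ≠ 0) (hG : ∀ t, HasDerivAt G (G' t) t)
    (hG' : HasDerivAt G' G'' (-Real.log ‖x‖)) {u : EuclideanSpace ℝ (Fin N) → ℝ}
    (hu : ∀ y, y ≠ 0 → u y = G (-Real.log ‖y‖)) :
    wOp α u x = Real.exp ((2 - α) * -Real.log ‖x‖) *
      (G'' - ((N : ℝ) - 2 + α) * G' (-Real.log ‖x‖)) := by
  have hr : 0 < ‖x‖ := norm_pos_iff.mpr hx
  have hn : ‖x‖ ≠ 0 := hr.ne'
  have hfd : ∀ y, y ≠ 0 →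
      fderiv ℝ u y = (-(G' (-Real.log ‖y‖) / ‖y‖ ^ 2)) • innerSL ℝ y := by
    intro y hy
    refine ((hasFDerivAt_comp_neg_log_norm hy (hG _)).congr_of_eventuallyEq ?_).fderiv
    filter_upwards [isOpen_ne.mem_nhds hy] with z hz using hu z hz
  have hsq : HasFDerivAt (fun y : EuclideanSpace ℝ (Fin N) => ‖y‖ ^ 2)
      (2 • innerSL ℝ x) x := (hasStrictFDerivAt_norm_sq x).hasFDerivAt
  have h2 : ∀ i : Fin N,
      fderiv ℝ (fun y => fderiv ℝ u y (EuclideanSpace.single i 1)) x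
        (EuclideanSpace.single i 1) =
      (G'' + 2 * G' (-Real.log ‖x‖)) / ‖x‖ ^ 4 * x i ^ 2
        - G' (-Real.log ‖x‖) / ‖x‖ ^ 2 := by
    intro i
    have hev : (fun y => fderiv ℝ u y (EuclideanSpace.single i 1)) =ᶠ[nhds x]
        fun y => -(G' (-Real.log ‖y‖) * (‖y‖ ^ 2)⁻¹ * y i) := by
      filter_upwards [isOpen_ne.mem_nhds hx] with y hy
      rw [hfd y hy]
      simp [EuclideanSpace.inner_single_right, div_eq_mul_inv]
    have hinv := (hasDerivAt_inv (pow_ne_zero 2 hn)).comp_hasFDerivAt x hsq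
    have hi : HasFDerivAt (fun y : EuclideanSpace ℝ (Fin N) => y i)
        (EuclideanSpace.proj i : EuclideanSpace ℝ (Fin N) →L[ℝ] ℝ) x :=
      (EuclideanSpace.proj i : EuclideanSpace ℝ (Fin N) →L[ℝ] ℝ).hasFDerivAt
    have hd := (((hasFDerivAt_comp_neg_log_norm hx hG').mul hinv).mul hi).neg
    rw [hev.fderiv_eq]
    refine (congrArg (fun L : EuclideanSpace ℝ (Fin N) →L[ℝ] ℝ =>
      L (EuclideanSpace.single i 1)) hd.fderiv).trans ?_
    simp [EuclideanSpace.inner_single_right]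
    field_simp
    ring
  have hlap : lap u x = (G'' - ((N : ℝ) - 2) * G' (-Real.log ‖x‖)) / ‖x‖ ^ 2 := by
    have hs : ∑ i : Fin N, x i ^ 2 = ‖x‖ ^ 2 := by
      rw [EuclideanSpace.norm_sq_eq]
      simp
    simp only [lap, h2]
    rw [Finset.sum_sub_distrib, ← Finset.mul_sum, hs]
    simp
    field_simp
    ring
  have hexp : Real.exp ((2 - α) * -Real.log ‖x‖) = ‖x‖ ^ α / ‖x‖ ^ 2 := by
    rw [← Real.rpow_natCast ‖x‖ 2, ← Real.rpow_sub hr, Real.rpow_def_of_pos hr]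
    congr 1
    push_cast
    ring
  have hα : ‖x‖ ^ (α - 2) = ‖x‖ ^ α / ‖x‖ ^ 2 := by
    rw [← Real.rpow_natCast ‖x‖ 2, ← Real.rpow_sub hr]
    norm_num
  rw [wOp, hlap, hfd x hx, hexp, hα]
  simp
  field_simp
  ring

theorem hasDerivAt_exp_mul_mul {k d t : ℝ} {f : ℝ → ℝ} (hf : HasDerivAt f d t) :
    HasDerivAt (fun s => Real.exp (k * s) * f s) (Real.exp (k * t) * (d + k * f t)) t := by
  refine ((((hasDerivAt_id t).const_mul k).exp).mul hf).congr_deriv ?_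
  simp
  ring

/-- The weighted operator conjugated by the Emden–Fowler transformation of exponent `k`. -/
theorem wOp_emdenFowler {N : ℕ} (α k : ℝ) {f f₁ f₂ : ℝ → ℝ}
    (hf : ∀ t, HasDerivAt f (f₁ t) t) (hf₁ : ∀ t, HasDerivAt f₁ (f₂ t) t)
    {u : EuclideanSpace ℝ (Fin N) → ℝ}
    (hu : ∀ y, y ≠ 0 → u y = Real.exp (k * -Real.log ‖y‖) * f (-Real.log ‖y‖))
    {x : EuclideanSpace ℝ (Fin N)} (hx : x ≠ 0) :
    wOp α u x = Real.exp ((k + 2 - α) * -Real.log ‖x‖) *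
      (f₂ (-Real.log ‖x‖) + (2 * k - ((N : ℝ) - 2 + α)) * f₁ (-Real.log ‖x‖)
        + k * (k - ((N : ℝ) - 2 + α)) * f (-Real.log ‖x‖)) := by
  rw [wOp_comp_neg_log_norm α (G := fun s => Real.exp (k * s) * f s) hx
    (fun t => hasDerivAt_exp_mul_mul (hf t))
    (hasDerivAt_exp_mul_mul ((hf₁ _).add ((hf _).const_mul k))) hu,
    show (k + 2 - α) * -Real.log ‖x‖ = (2 - α) * -Real.log ‖x‖ + k * -Real.log ‖x‖ by ring,
    Real.exp_add]
  ring

/-- the Emden–Fowler transformation `u(x) = |x|^{−κ₁} φ(−ln|x|)` turns the weighted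
fourth-order equation into the ODE `φ'''' − K₂ φ'' + K₀ φ = |φ|^{2**_α−2} φ`. -/
theorem stmt2 (N : ℕ) (hN : 2 ≤ N) (α : ℝ) (hα1 : ((4 : ℝ) - N)/2 < α) (hα2 : α < 2)
    (φ : ℝ → ℝ) (hφ : ContDiff ℝ 4 φ) :
    let κ₁ : ℝ := ((N : ℝ) - 4 + 2*α)/2
    let K₂ : ℝ := (((N : ℝ) + α - 2)^2 + (2-α)^2)/2
    let K₀ : ℝ := (N : ℝ)^2 * ((N : ℝ) - 4 + 2*α)^2/16
    let u : EuclideanSpace ℝ (Fin N) → ℝ := fun x => ‖x‖ ^ (-κ₁) * φ (-Real.log ‖x‖)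
    ∀ x : EuclideanSpace ℝ (Fin N), x ≠ 0 →
      (wOp α (wOp α u) x = |u x| ^ (pexp N α - 2) * u x ↔
        iteratedDeriv 4 φ (-Real.log ‖x‖) - K₂ * iteratedDeriv 2 φ (-Real.log ‖x‖)
            + K₀ * φ (-Real.log ‖x‖)
          = |φ (-Real.log ‖x‖)| ^ (pexp N α - 2) * φ (-Real.log ‖x‖)) := by
  intro κ₁ K₂ K₀ u x hx
  have hd : ∀ m : ℕ, m < 4 → ∀ t,
      HasDerivAt (iteratedDeriv m φ) (iteratedDeriv (m + 1) φ t) t := by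
    intro m hm t
    rw [iteratedDeriv_succ]
    exact ((hφ.differentiable_iteratedDeriv m (by exact_mod_cast hm)) t).hasDerivAt
  have hd0 : ∀ t, HasDerivAt φ (iteratedDeriv 1 φ t) t := by
    simpa using hd 0 (by norm_num)
  have hd1 := hd 1 (by norm_num)
  have hd2 := hd 2 (by norm_num)
  have hd3 := hd 3 (by norm_num)
  have hu : ∀ y, y ≠ 0 → u y = Real.exp (κ₁ * -Real.log ‖y‖) * φ (-Real.log ‖y‖) := by
    intro y hy
    simp only [u]
    rw [Real.rpow_def_of_pos (norm_pos_iff.mpr hy)]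
    ring_nf
  have h1 := fun y (hy : y ≠ 0) => wOp_emdenFowler α κ₁ hd0 hd1 hu hy
  have hg : ∀ b c t, HasDerivAt
      (fun s => iteratedDeriv 2 φ s + b * iteratedDeriv 1 φ s + c * φ s)
      (iteratedDeriv 3 φ t + b * iteratedDeriv 2 φ t + c * iteratedDeriv 1 φ t) t :=
    fun b c t => ((hd2 t).add ((hd1 t).const_mul b)).add ((hd0 t).const_mul c)
  have hg' : ∀ b c t, HasDerivAt
      (fun s => iteratedDeriv 3 φ s + b * iteratedDeriv 2 φ s + c * iteratedDeriv 1 φ s)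
      (iteratedDeriv 4 φ t + b * iteratedDeriv 3 φ t + c * iteratedDeriv 2 φ t) t :=
    fun b c t => ((hd3 t).add ((hd2 t).const_mul b)).add ((hd1 t).const_mul c)
  rw [wOp_emdenFowler α (κ₁ + 2 - α) (hg _ _) (hg' _ _) h1 hx, hu x hx, abs_mul, Real.abs_exp,
    Real.mul_rpow (Real.exp_pos _).le (abs_nonneg _), ← Real.exp_mul]
  generalize -Real.log ‖x‖ = t
  have hκ : (N : ℝ) - 4 + 2 * α ≠ 0 := by linarith
  have hexp : (κ₁ + 2 - α + 2 - α) * t = κ₁ * t * (pexp N α - 2) + κ₁ * t := by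
    simp only [κ₁, pexp]
    field_simp
    ring
  rw [hexp, Real.exp_add]
  generalize |φ t| ^ (pexp N α - 2) = q
  have hE : Real.exp (κ₁ * t * (pexp N α - 2)) * Real.exp (κ₁ * t) ≠ 0 :=
    (mul_pos (Real.exp_pos _) (Real.exp_pos _)).ne'
  rw [show Real.exp (κ₁ * t * (pexp N α - 2)) * q * (Real.exp (κ₁ * t) * φ t) =
    Real.exp (κ₁ * t * (pexp N α - 2)) * Real.exp (κ₁ * t) * (q * φ t) by ring,
    mul_right_inj' hE]
  refine Eq.congr_left ?_
  simp only [κ₁, K₂, K₀]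
  ring

end
end

section
/- Let N ≥ 2 be an integer and let α be a real number with (4−N)/2 < α < 2. Then for every radial function u ∈ C_c^∞(ℝ^N) (i.e., u(x) depends only on |x|), the inequality ∫_{ℝ^N} |div(|x|^α ∇u)(x)|² dx ≥ S^{rad}_{N,α} (∫_{ℝ^N} |u(x)|^{2**_α} dx)^{2/2**_α} holds, where S^{rad}_{N,α} = ((2−α)/2)^{4−(4−2α)/N} (2π^{N/2}/Γ(N/2))^{(4−2α)/N} C(2N/(2−α)) and C(M) = (M−4)(M−2)M(M+2)(Γ(M/2)²/(2Γ(M)))^{4/M}. -/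
open Real MeasureTheory Filter

noncomputable section

/-- The square of the clamp of `θ` to the unit interval. -/
def clampSq (θ : ℝ) : ℝ := (max 0 (min θ 1)) ^ 2

/-- The primitive of `clampSq` vanishing at the origin. -/
def clampPrim (θ : ℝ) : ℝ := ∫ τ in (0 : ℝ)..θ, clampSq τ

/-- The defect `√(1 - x^(2/b))`, equal to `|tanh|` along the extremal `x = cosh^(-b)`. -/
def defect (b x : ℝ) : ℝ := √(1 - x ^ (2 / b))

/-- The density of the position part of the calibrating function. -/
def posDensity (b x : ℝ) : ℝ :=
  b * x * ((b + 1) * (b + 3) * (4 * defect b x - 4 / 3 * defect b x ^ 3))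

/-- The position part of the calibrating function. -/
def calibPos (b x : ℝ) : ℝ := ∫ ρ in (0 : ℝ)..x, posDensity b ρ

/-- The calibrating function on the phase plane of position and velocity. -/
def calib (b x y : ℝ) : ℝ :=
  2 * b ^ 2 * x ^ 2 * ((b + 1) * clampPrim (y / (b * x)) - y / (b * x)) + calibPos b x

lemma continuous_clampSq : Continuous clampSq := by
  unfold clampSq; fun_prop

lemma hasDerivAt_clampPrim (θ : ℝ) : HasDerivAt clampPrim (clampSq θ) θ :=
  (continuous_clampSq.integral_hasStrictDerivAt 0 θ).hasDerivAt

lemma clampPrim_of_nonpos {θ : ℝ} (h : θ ≤ 0) : clampPrim θ = 0 := by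
  unfold clampPrim
  rw [intervalIntegral.integral_congr (g := fun _ => (0 : ℝ))]
  · simp
  · intro τ hτ
    rw [Set.uIcc_of_ge h] at hτ
    simp [clampSq, max_eq_left ((min_le_left τ 1).trans hτ.2)]

lemma clampPrim_of_mem {θ : ℝ} (h0 : 0 ≤ θ) (h1 : θ ≤ 1) : clampPrim θ = θ ^ 3 / 3 := by
  unfold clampPrim
  rw [intervalIntegral.integral_congr (g := fun τ => τ ^ 2)]
  · rw [integral_pow]; norm_num
  · intro τ hτ
    rw [Set.uIcc_of_le h0] at hτ
    simp [clampSq, min_eq_left (hτ.2.trans h1), max_eq_right hτ.1]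

lemma clampPrim_of_one_le {θ : ℝ} (h : 1 ≤ θ) : clampPrim θ = θ - 2 / 3 := by
  have h1 : clampPrim θ = clampPrim 1 + ∫ τ in (1 : ℝ)..θ, clampSq τ := by
    unfold clampPrim
    rw [intervalIntegral.integral_add_adjacent_intervals] <;>
      exact continuous_clampSq.intervalIntegrable _ _
  rw [h1, clampPrim_of_mem zero_le_one le_rfl,
    intervalIntegral.integral_congr (g := fun _ => (1 : ℝ))]
  · simp; ring
  · intro τ hτ
    rw [Set.uIcc_of_le h] at hτ
    simp [clampSq, min_eq_right hτ.1]

lemma abs_clampPrim_le (θ : ℝ) : |clampPrim θ| ≤ |θ| := by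
  rcases le_total θ 0 with h | h
  · simp [clampPrim_of_nonpos h]
  rcases le_total θ 1 with h1 | h1
  · rw [clampPrim_of_mem h h1, abs_of_nonneg (by positivity), abs_of_nonneg h]
    nlinarith [mul_nonneg h h, mul_nonneg h (sub_nonneg.2 h1), mul_nonneg (mul_nonneg h h) (sub_nonneg.2 h1)]
  · rw [clampPrim_of_one_le h1, abs_of_nonneg (by linarith), abs_of_nonneg h]
    linarith

/-- The Hamilton–Jacobi inequality in the reduced variables. -/
lemma hamiltonJacobi_reduced {b s θ : ℝ} (hb : 0 < b) (hs0 : 0 ≤ s) (hs1 : s ≤ 1) :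
    0 ≤ ((b + 2) ^ 2 + b ^ 2) * θ ^ 2
      + ((b + 2) ^ 2 - (b + 1) * (b + 3) * (1 - s ^ 2) ^ 2)
      - ((b + 1) * clampSq θ - 1) ^ 2 + 2 * b * θ ^ 2 * ((b + 1) * clampSq θ - 1)
      - 4 * b * θ * ((b + 1) * clampPrim θ - θ)
      - (b + 1) * (b + 3) * (4 * s - 4 / 3 * s ^ 3) * θ := by
  have hB : 0 ≤ 4 * s - 4 / 3 * s ^ 3 := by
    nlinarith [mul_nonneg hs0 (sub_nonneg.2 hs1), mul_nonneg hs0 (mul_nonneg hs0 (sub_nonneg.2 hs1))]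
  have hs2 : s ^ 2 ≤ 1 := by nlinarith
  have hq : (1 - s ^ 2) ^ 2 ≤ 1 := by nlinarith [sq_nonneg s]
  have hK : 0 < (b + 1) * (b + 3) := by positivity
  rcases le_total θ 0 with h | h
  · have hc : clampSq θ = 0 := by simp [clampSq, max_eq_left ((min_le_left θ 1).trans h)]
    rw [hc, clampPrim_of_nonpos h]
    have e1 : 0 ≤ (b + 1) * (b + 3) * (1 - (1 - s ^ 2) ^ 2) := mul_nonneg hK.le (by linarith)
    have e2 : 0 ≤ (b + 1) * (b + 3) * (4 * s - 4 / 3 * s ^ 3) * (-θ) :=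
      mul_nonneg (mul_nonneg hK.le hB) (by linarith)
    have e3 : 0 ≤ (2 * b ^ 2 + 6 * b + 4) * θ ^ 2 := by positivity
    linarith
  rcases le_total θ 1 with h1 | h1
  · have hc : clampSq θ = θ ^ 2 := by simp [clampSq, min_eq_left h1, max_eq_right h]
    rw [hc, clampPrim_of_mem h h1]
    have e : 0 ≤ (b + 1) * (b + 3) * ((θ - s) ^ 2 * (2 - (θ ^ 2 + 2 * θ * s + 3 * s ^ 2) / 3)) := by
      refine mul_nonneg hK.le (mul_nonneg (sq_nonneg _) ?_)
      have : θ * s ≤ 1 := mul_le_one₀ h1 hs0 hs1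
      have : θ ^ 2 ≤ 1 := by nlinarith
      linarith
    linarith
  · have hc : clampSq θ = 1 := by simp [clampSq, min_eq_right h1]
    rw [hc, clampPrim_of_one_le h1]
    have e1 : 0 ≤ 4 * (b + 1) * (θ - 1) ^ 2 := by positivity
    have e2 : 0 ≤ (b + 1) * (b + 3) * ((1 - s) ^ 2 * (2 - (1 + 2 * s + 3 * s ^ 2) / 3)) :=
      mul_nonneg hK.le (mul_nonneg (sq_nonneg _) (by nlinarith))
    have e3 : 0 ≤ (b + 1) * (b + 3) * ((8 / 3 - 4 * s + 4 / 3 * s ^ 3) * (θ - 1)) := by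
      refine mul_nonneg hK.le (mul_nonneg ?_ (by linarith))
      have : 0 ≤ 4 / 3 * ((1 - s) ^ 2 * (s + 2)) := by positivity
      linarith
    linarith

lemma continuous_posDensity {b : ℝ} (hb : 0 < b) : Continuous (posDensity b) := by
  have : Continuous (defect b) := by
    unfold defect
    exact (continuous_const.sub (Real.continuous_rpow_const (by positivity))).sqrt
  unfold posDensity
  fun_prop

lemma hasDerivAt_calibPos {b : ℝ} (hb : 0 < b) (x : ℝ) :
    HasDerivAt (calibPos b) (posDensity b x) x :=
  ((continuous_posDensity hb).integral_hasStrictDerivAt 0 x).hasDerivAt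

lemma rpow_critical {b x : ℝ} (hx : 0 < x) :
    x ^ (2 + 4 / b) = x ^ 2 * (x ^ (2 / b)) ^ 2 := by
  rw [Real.rpow_add hx, ← Real.rpow_natCast (x ^ (2 / b)), ← Real.rpow_mul hx.le]
  norm_num
  left; congr 1; ring

/-- Along a positive trajectory, the calibrating function grows at most at the rate of the
Lagrangian. -/
lemma calib_deriv_le {b : ℝ} (hb : 0 < b) {w w1 : ℝ → ℝ} {w2 t : ℝ}
    (h0 : HasDerivAt w (w1 t) t) (h1 : HasDerivAt w1 w2 t) (hpos : 0 < w t) (hle : w t ≤ 1) :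
    ∃ d, HasDerivAt (fun t => calib b (w t) (w1 t)) d t ∧
      d ≤ w2 ^ 2 + ((b + 2) ^ 2 + b ^ 2) * w1 t ^ 2 + (b * (b + 2)) ^ 2 * w t ^ 2
        - b ^ 2 * ((b + 1) * (b + 3)) * |w t| ^ (2 + 4 / b) := by
  have hbw : b * w t ≠ 0 := by positivity
  have hθ := h1.div (h0.const_mul b) hbw
  have hP := (hasDerivAt_clampPrim (w1 t / (b * w t))).comp t hθ
  have hV := (((h0.pow 2).const_mul (2 * b ^ 2)).mul ((hP.const_mul (b + 1)).sub hθ)).add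
    ((hasDerivAt_calibPos hb (w t)).comp t h0)
  refine ⟨_, hV, ?_⟩
  obtain ⟨θ, hθd⟩ : ∃ θ, θ = w1 t / (b * w t) := ⟨_, rfl⟩
  have hw1 : w1 t = b * w t * θ := by rw [hθd]; field_simp
  have hq0 : 0 ≤ (w t) ^ (2 / b) := by positivity
  have hq1 : (w t) ^ (2 / b) ≤ 1 := Real.rpow_le_one hpos.le hle (by positivity)
  have hs0 : 0 ≤ defect b (w t) := Real.sqrt_nonneg _
  have hs1 : defect b (w t) ≤ 1 := by
    exact Real.sqrt_le_iff.2 ⟨zero_le_one, by linarith⟩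
  have hs2 : (w t) ^ (2 / b) = 1 - defect b (w t) ^ 2 := by
    unfold defect; rw [Real.sq_sqrt (by linarith)]; ring
  have key := hamiltonJacobi_reduced (θ := θ) hb hs0 hs1
  rw [abs_of_pos hpos, rpow_critical hpos, hs2]
  simp only [Function.comp, Pi.pow_apply, Pi.div_apply, Pi.sub_apply]
  rw [← hθd]
  unfold posDensity
  rw [hw1]
  generalize defect b (w t) = s at *
  generalize clampSq θ = c at *
  generalize clampPrim θ = P at *
  generalize w t = x at *
  have hsq := sq_nonneg (w2 - b * x * ((b + 1) * c - 1))
  have hk := mul_nonneg (sq_nonneg (b * x)) key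
  have e : (w2 * (b * x) - b * x * θ * (b * (b * x * θ))) / (b * x) ^ 2 
      = (w2 - b ^ 2 * x * θ ^ 2) / (b * x) := by field_simp
  rw [e]
  have e2 : 2 * b ^ 2 * x ^ 2 * ((b + 1) * (c * ((w2 - b ^ 2 * x * θ ^ 2) / (b * x))) - (w2 - b ^ 2 * x * θ ^ 2) / (b * x)) = 2 * b * x * ((b + 1) * c - 1) * (w2 - b ^ 2 * x * θ ^ 2) := by field_simp
  rw [e2]
  norm_num
  nlinarith [hsq, hk]

lemma abs_calib_le {b : ℝ} (hb : 0 < b) (x y : ℝ) :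
    |calib b x y| ≤ 2 * b * (b + 2) * |x * y| + |calibPos b x| := by
  unfold calib
  refine (abs_add_le _ _).trans (add_le_add_left ?_ _)
  have h1 : |(b + 1) * clampPrim (y / (b * x)) - y / (b * x)| ≤ (b + 2) * |y / (b * x)| := by
    refine (abs_sub _ _).trans ?_
    rw [abs_mul, abs_of_pos (by positivity : 0 < b + 1)]
    nlinarith [abs_clampPrim_le (y / (b * x))]
  rw [abs_mul, abs_of_nonneg (by positivity : 0 ≤ 2 * b ^ 2 * x ^ 2)]
  refine (mul_le_mul_of_nonneg_left h1 (by positivity)).trans ?_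
  rcases eq_or_ne x 0 with rfl | hx
  · simp
  · rw [abs_div, abs_mul, abs_of_pos hb, abs_mul x y, ← sq_abs x]
    have : |x| ≠ 0 := abs_ne_zero.2 hx
    apply le_of_eq
    field_simp

lemma tendsto_calib_zero {b : ℝ} (hb : 0 < b) {w w1 : ℝ → ℝ} {l : Filter ℝ} {c : ℝ}
    (h0 : Tendsto w l (nhds 0)) (h1 : Tendsto w1 l (nhds c)) :
    Tendsto (fun t => calib b (w t) (w1 t)) l (nhds 0) := by
  have hP : Tendsto (fun t => |calibPos b (w t)|) l (nhds 0) := by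
    have := ((hasDerivAt_calibPos hb 0).continuousAt.tendsto.comp h0).abs
    simpa [calibPos, Function.comp_def] using this
  have hM : Tendsto (fun t => 2 * b * (b + 2) * |w t * w1 t|) l (nhds 0) := by
    have := ((h0.mul h1).abs).const_mul (2 * b * (b + 2))
    simpa using this
  refine squeeze_zero_norm (fun t => abs_calib_le hb (w t) (w1 t)) ?_
  simpa using hM.add hP

/-- The Lagrangian of the reduced one-dimensional problem. -/
def lagr (b x y z : ℝ) : ℝ :=
  z ^ 2 + ((b + 2) ^ 2 + b ^ 2) * y ^ 2 + (b * (b + 2)) ^ 2 * x ^ 2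
    - b ^ 2 * ((b + 1) * (b + 3)) * |x| ^ (2 + 4 / b)

lemma lagr_nonneg {b x y z : ℝ} (hb : 0 < b) (hx : |x| ≤ 1) : 0 ≤ lagr b x y z := by
  have h1 : |x| ^ (2 + 4 / b) ≤ x ^ 2 := by
    rw [← sq_abs, ← Real.rpow_natCast |x| 2]
    refine Real.rpow_le_rpow_of_exponent_ge' (abs_nonneg x) hx (by norm_num) ?_
    have : 0 < 4 / b := by positivity
    push_cast; linarith
  have h2 : b ^ 2 * ((b + 1) * (b + 3)) * |x| ^ (2 + 4 / b) ≤
      b ^ 2 * ((b + 1) * (b + 3)) * x ^ 2 := mul_le_mul_of_nonneg_left h1 (by positivity)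
  unfold lagr
  nlinarith [sq_nonneg z, mul_nonneg (add_nonneg (sq_nonneg (b + 2)) (sq_nonneg b)) (sq_nonneg y),
    mul_nonneg (sq_nonneg b) (sq_nonneg x)]

lemma continuous_lagr {b : ℝ} (hb : 0 < b) {w w1 w2 : ℝ → ℝ} (h0 : Continuous w)
    (h1 : Continuous w1) (h2 : Continuous w2) :
    Continuous fun t => lagr b (w t) (w1 t) (w2 t) := by
  have : Continuous fun t => |w t| ^ (2 + 4 / b) := h0.abs.rpow_const fun t => Or.inr (by positivity)
  unfold lagr
  fun_prop

lemma calib_one_zero (b : ℝ) : calib b 1 0 = calibPos b 1 := by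
  simp [calib, clampPrim_of_nonpos le_rfl]

/-- The action accumulated before a normalized maximum, when the trajectory stays positive. -/
lemma le_action_of_pos {b : ℝ} (hb : 0 < b) {w w1 w2 : ℝ → ℝ}
    (h0 : ∀ t, HasDerivAt w (w1 t) t) (h1 : ∀ t, HasDerivAt w1 (w2 t) t) (h2 : Continuous w2)
    (hle : ∀ t, |w t| ≤ 1) {T τ : ℝ} (hT : T ≤ τ) (hτ : w τ = 1) (hτ1 : w1 τ = 0)
    (hT0 : 0 ≤ w T) (hpos : ∀ t ∈ Set.Ioc T τ, 0 < w t) :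
    calibPos b 1 - calib b (w T) (w1 T) ≤ ∫ t in T..τ, lagr b (w t) (w1 t) (w2 t) := by
  have hw : Continuous w := continuous_iff_continuousAt.2 fun t => (h0 t).continuousAt
  have hw1 : Continuous w1 := continuous_iff_continuousAt.2 fun t => (h1 t).continuousAt
  have hd : ∀ t, ∃ d, 0 < w t → HasDerivAt (fun t => calib b (w t) (w1 t)) d t ∧
      d ≤ lagr b (w t) (w1 t) (w2 t) := by
    intro t
    by_cases h : 0 < w t
    · obtain ⟨d, hd⟩ := calib_deriv_le hb (h0 t) (h1 t) h ((le_abs_self _).trans (hle t))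
      exact ⟨d, fun _ => hd⟩
    · exact ⟨0, fun h' => absurd h' h⟩
  choose d hd using hd
  have hcont : ∀ t ∈ Set.Icc T τ, ContinuousAt (fun t => calib b (w t) (w1 t)) t := by
    intro t ht
    rcases lt_or_ge 0 (w t) with h | h
    · exact (hd t h).1.continuousAt
    · have htT : t = T := by
        by_contra hne
        exact absurd (hpos t ⟨lt_of_le_of_ne ht.1 (Ne.symm hne), ht.2⟩) h.not_gt
      have hz : w t = 0 := le_antisymm h (htT ▸ hT0)
      have := tendsto_calib_zero hb (hz ▸ hw.tendsto t) (hw1.tendsto t)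
      have hc0 : calib b (w t) (w1 t) = 0 := by simp [hz, calib, calibPos]
      show Tendsto _ _ (nhds (calib b (w t) (w1 t)))
      rwa [hc0]
  have := intervalIntegral.sub_le_integral_of_hasDeriv_right_of_le (g' := d) hT
    (fun t ht => (hcont t ht).continuousWithinAt)
    (fun t ht => (hd t (hpos t ⟨ht.1, ht.2.le⟩)).1.hasDerivWithinAt)
    ((continuous_lagr hb hw hw1 h2).integrableOn_Icc)
    (fun t ht => (hd t (hpos t ⟨ht.1, ht.2.le⟩)).2)
  rwa [hτ, hτ1, calib_one_zero] at this

lemma le_action_left {b : ℝ} (hb : 0 < b) {w w1 w2 : ℝ → ℝ}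
    (h0 : ∀ t, HasDerivAt w (w1 t) t) (h1 : ∀ t, HasDerivAt w1 (w2 t) t) (h2 : Continuous w2)
    (hle : ∀ t, |w t| ≤ 1) {T τ : ℝ} (hT : T ≤ τ) (hτ : w τ = 1) (hτ1 : w1 τ = 0) :
    calibPos b 1 - |calib b (w T) (w1 T)| ≤ ∫ t in T..τ, lagr b (w t) (w1 t) (w2 t) := by
  have hw : Continuous w := continuous_iff_continuousAt.2 fun t => (h0 t).continuousAt
  have hw1 : Continuous w1 := continuous_iff_continuousAt.2 fun t => (h1 t).continuousAt
  have hL := continuous_lagr hb hw hw1 h2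
  by_cases hz : ∃ t ∈ Set.Icc T τ, w t ≤ 0
  · obtain ⟨t₁, ⟨ht₁, hwt₁⟩, hmax⟩ := (isCompact_Icc.inter_right
      (isClosed_le hw continuous_const)).exists_isGreatest (show (Set.Icc T τ ∩ {t | w t ≤ 0}).Nonempty from hz)
    have hpos : ∀ t ∈ Set.Ioc t₁ τ, 0 < w t := by
      intro t ht
      by_contra h
      exact absurd (hmax ⟨⟨ht₁.1.trans ht.1.le, ht.2⟩, not_lt.1 h⟩) ht.1.not_ge
    have hlt : t₁ < τ := lt_of_le_of_ne ht₁.2 (by rintro rfl; simp [hτ] at hwt₁; linarith)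
    have hw0 : w t₁ = 0 := by
      refine le_antisymm hwt₁ (ge_of_tendsto (x := nhdsWithin t₁ (Set.Ioi t₁))
        (hw.continuousAt.tendsto.mono_left nhdsWithin_le_nhds) ?_)
      filter_upwards [Ioc_mem_nhdsGT hlt] with t ht using (hpos t ht).le
    have h := le_action_of_pos hb h0 h1 h2 hle hlt.le hτ hτ1 hw0.ge hpos
    have hc0 : calib b (w t₁) (w1 t₁) = 0 := by simp [hw0, calib, calibPos]
    rw [← intervalIntegral.integral_add_adjacent_intervals (hL.intervalIntegrable T t₁)
      (hL.intervalIntegrable t₁ τ)]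
    have := intervalIntegral.integral_nonneg (μ := volume) ht₁.1
      (fun t _ => lagr_nonneg (y := w1 t) (z := w2 t) hb (hle t))
    linarith [abs_nonneg (calib b (w T) (w1 T))]
  · push Not at hz
    have := le_action_of_pos hb h0 h1 h2 hle hT hτ hτ1 (hz T ⟨le_rfl, hT⟩).le
      (fun t ht => hz t ⟨ht.1.le, ht.2⟩)
    linarith [le_abs_self (calib b (w T) (w1 T))]

lemma le_action {b : ℝ} (hb : 0 < b) {w w1 w2 : ℝ → ℝ}
    (h0 : ∀ t, HasDerivAt w (w1 t) t) (h1 : ∀ t, HasDerivAt w1 (w2 t) t) (h2 : Continuous w2)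
    (hle : ∀ t, |w t| ≤ 1) {T τ T' : ℝ} (hT : T ≤ τ) (hT' : τ ≤ T') (hτ : w τ = 1)
    (hτ1 : w1 τ = 0) :
    2 * calibPos b 1 - |calib b (w T) (w1 T)| - |calib b (w T') (-w1 T')| ≤
      ∫ t in T..T', lagr b (w t) (w1 t) (w2 t) := by
  have hw : Continuous w := continuous_iff_continuousAt.2 fun t => (h0 t).continuousAt
  have hw1 : Continuous w1 := continuous_iff_continuousAt.2 fun t => (h1 t).continuousAt
  have hL := continuous_lagr hb hw hw1 h2
  have hl := le_action_left hb h0 h1 h2 hle hT hτ hτ1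
  have hr := le_action_left (w := fun t => w (-t)) (w1 := fun t => -w1 (-t))
    (w2 := fun t => w2 (-t)) (T := -T') (τ := -τ) hb
    (fun t => by simpa [Function.comp_def] using (h0 (-t)).comp t (hasDerivAt_neg t))
    (fun t => by simpa [Function.comp_def] using ((h1 (-t)).comp t (hasDerivAt_neg t)).fun_neg)
    (by fun_prop) (fun t => hle _) (by linarith) (by simpa using hτ) (by simpa using hτ1)
  have hsym : ∀ t, lagr b (w (-t)) (-w1 (-t)) (w2 (-t)) = lagr b (w (-t)) (w1 (-t)) (w2 (-t)) :=
    fun t => by simp [lagr]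
  simp only [hsym, neg_neg] at hr
  rw [intervalIntegral.integral_comp_neg (fun t => lagr b (w t) (w1 t) (w2 t))] at hr
  simp only [neg_neg] at hr
  rw [← intervalIntegral.integral_add_adjacent_intervals (hL.intervalIntegrable T τ)
      (hL.intervalIntegrable τ T')]
  linarith

/-- The energy bound for trajectories normalized to have maximum one. -/
lemma energy_ge_normalized {b : ℝ} (hb : 0 < b) {w w1 w2 : ℝ → ℝ}
    (h0 : ∀ t, HasDerivAt w (w1 t) t) (h1 : ∀ t, HasDerivAt w1 (w2 t) t) (h2 : Continuous w2)
    (hle : ∀ t, |w t| ≤ 1) {τ : ℝ} (hτ : w τ = 1)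
    (hb0 : Tendsto w atBot (nhds 0)) (hb1 : Tendsto w1 atBot (nhds 0))
    (ht0 : Tendsto w atTop (nhds 0)) (ht1 : Tendsto w1 atTop (nhds 0))
    (hsqint : Integrable fun t => (w2 t + 2 * w1 t - b * (b + 2) * w t) ^ 2)
    (hintp : Integrable fun t => |w t| ^ (2 + 4 / b)) :
    b ^ 2 * ((b + 1) * (b + 3)) * (∫ t, |w t| ^ (2 + 4 / b)) + 2 * calibPos b 1 ≤
      ∫ t, (w2 t + 2 * w1 t - b * (b + 2) * w t) ^ 2 := by
  have hw : Continuous w := continuous_iff_continuousAt.2 fun t => (h0 t).continuousAt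
  have hw1 : Continuous w1 := continuous_iff_continuousAt.2 fun t => (h1 t).continuousAt
  have hL := continuous_lagr hb hw hw1 h2
  have hwp : Continuous fun t => |w t| ^ (2 + 4 / b) :=
    hw.abs.rpow_const fun t => Or.inr (by positivity)
  have hτ1 : w1 τ = 0 := by
    refine IsLocalMax.hasDerivAt_eq_zero (f := w) ?_ (h0 τ)
    exact Eventually.of_forall fun t => by rw [hτ]; exact (le_abs_self _).trans (hle t)
  obtain ⟨D, hD⟩ : ∃ D : ℝ → ℝ, D = fun t =>
    2 * w1 t ^ 2 - 2 * b * (b + 2) * (w t * w1 t) - 2 * b * (b + 2) * w t ^ 2 := ⟨_, rfl⟩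
  have hDd : ∀ t, HasDerivAt D (4 * w1 t * w2 t - 2 * b * (b + 2) * (w1 t * w1 t + w t * w2 t)
      - 2 * b * (b + 2) * (2 * w t * w1 t)) t := by
    intro t
    rw [hD]
    refine (((((h1 t).fun_pow 2).const_mul 2).fun_sub
      (((h0 t).fun_mul (h1 t)).const_mul (2 * b * (b + 2)))).fun_sub
      (((h0 t).fun_pow 2).const_mul (2 * b * (b + 2)))).congr_deriv ?_
    norm_num
    ring
  have hDlim : ∀ {l : Filter ℝ}, Tendsto w l (nhds 0) → Tendsto w1 l (nhds 0) →
      Tendsto D l (nhds 0) := by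
    intro l a0 a1
    rw [hD]
    have := (((a1.pow 2).const_mul 2).sub ((a0.mul a1).const_mul (2 * b * (b + 2)))).sub
      ((a0.pow 2).const_mul (2 * b * (b + 2)))
    simpa using this
  set κ := b ^ 2 * ((b + 1) * (b + 3)) with hκ
  have hid : ∀ T T' : ℝ, ∫ t in T..T', ((w2 t + 2 * w1 t - b * (b + 2) * w t) ^ 2
      - κ * |w t| ^ (2 + 4 / b)) = (∫ t in T..T', lagr b (w t) (w1 t) (w2 t)) + (D T' - D T) := by
    intro T T'
    rw [← intervalIntegral.integral_eq_sub_of_hasDerivAt (fun t _ => hDd t)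
      (Continuous.intervalIntegrable (by fun_prop) _ _),
      ← intervalIntegral.integral_add (hL.intervalIntegrable _ _)
      (Continuous.intervalIntegrable (by fun_prop) _ _)]
    refine intervalIntegral.integral_congr fun t _ => ?_
    simp only [lagr, hκ]
    ring
  have hlim := intervalIntegral_tendsto_integral (hsqint.sub (hintp.const_mul κ))
    tendsto_neg_atTop_atBot tendsto_id
  have hc1 := ((tendsto_calib_zero hb hb0 hb1).comp tendsto_neg_atTop_atBot).abs
  have hc2 := (tendsto_calib_zero hb ht0 (by simpa using ht1.neg)).abs
  have hd1 := (hDlim hb0 hb1).comp tendsto_neg_atTop_atBot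
  have hd2 := hDlim ht0 ht1
  have hlow := ((tendsto_const_nhds (x := 2 * calibPos b 1)).sub hc1).sub hc2 |>.add (hd2.sub hd1)
  simp only [abs_zero, sub_zero, add_zero] at hlow
  have hfin := le_of_tendsto_of_tendsto hlow hlim (by
    filter_upwards [eventually_ge_atTop τ, eventually_ge_atTop (-τ)] with R hR hR'
    have := le_action hb h0 h1 h2 hle (T := -R) (τ := τ) (T' := R) (by linarith) hR hτ hτ1
    simp only [id, Pi.sub_apply]
    rw [hid]
    simp only [Function.comp]
    linarith)
  simp only [Pi.sub_apply] at hfin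
  rw [integral_sub hsqint (hintp.const_mul κ), integral_const_mul] at hfin
  linarith

lemma integral_defect_pow {b c : ℝ} (hb : 0 < b) (hc : 0 < c) :
    ∫ ρ in (0 : ℝ)..1, ρ * (1 - ρ ^ (2 / b)) ^ (c - 1) = b / 2 * ProbabilityTheory.beta b c := by
  have hb2 : 0 < b / 2 := by positivity
  have hsub := integral_comp_rpow_Ioi_of_pos
    (g := (Set.Ioc (0 : ℝ) 1).indicator fun ρ => ρ * (1 - ρ ^ (2 / b)) ^ (c - 1)) hb2
  rw [setIntegral_indicator measurableSet_Ioc] at hsub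
  have hinter : Set.Ioi (0 : ℝ) ∩ Set.Ioc 0 1 = Set.Ioc 0 1 := by
    ext x; simp only [Set.mem_inter_iff, Set.mem_Ioi, Set.mem_Ioc]; tauto
  rw [hinter] at hsub
  rw [intervalIntegral.integral_of_le zero_le_one, ← hsub]
  have hbeta : ProbabilityTheory.beta b c =
      ∫ x in (0 : ℝ)..1, x ^ (b - 1) * (1 - x) ^ (c - 1) := by
    rw [ProbabilityTheory.beta_eq_betaIntegralReal b c hb hc, Complex.betaIntegral]
    have : ∀ x ∈ Set.uIcc (0 : ℝ) 1, (x : ℂ) ^ ((b : ℂ) - 1) * (1 - (x : ℂ)) ^ ((c : ℂ) - 1) =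
        ((x ^ (b - 1) * (1 - x) ^ (c - 1) : ℝ) : ℂ) := by
      intro x hx
      rw [Set.uIcc_of_le zero_le_one] at hx
      push_cast
      rw [Complex.ofReal_cpow hx.1, Complex.ofReal_cpow (by linarith [hx.2])]
      push_cast
      rfl
    rw [intervalIntegral.integral_congr this, intervalIntegral.integral_ofReal, Complex.ofReal_re]
  rw [hbeta, intervalIntegral.integral_of_le zero_le_one, ← integral_const_mul,
    ← integral_indicator measurableSet_Ioi, ← integral_indicator measurableSet_Ioc]
  congr 1
  ext x
  by_cases hx : x ∈ Set.Ioc (0 : ℝ) 1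
  · have hxp : x ^ (b / 2) ∈ Set.Ioc (0 : ℝ) 1 :=
      ⟨Real.rpow_pos_of_pos hx.1 _, Real.rpow_le_one hx.1.le hx.2 hb2.le⟩
    rw [Set.indicator_of_mem (show x ∈ Set.Ioi (0 : ℝ) from hx.1), Set.indicator_of_mem hx,
      Set.indicator_of_mem hxp, ← Real.rpow_mul hx.1.le]
    have e1 : b / 2 * (2 / b) = 1 := by field_simp
    rw [e1, Real.rpow_one, smul_eq_mul]
    have e2 : x ^ (b - 1) = x ^ (b / 2 - 1) * x ^ (b / 2) := by
      rw [← Real.rpow_add hx.1]; congr 1; ring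
    rw [e2]; ring
  · rw [Set.indicator_of_notMem hx]
    by_cases hx0 : x ∈ Set.Ioi (0 : ℝ)
    · have hx1 : 1 < x := by
        by_contra h; exact hx ⟨hx0, not_lt.1 h⟩
      rw [Set.indicator_of_mem hx0, Set.indicator_of_notMem, smul_zero]
      exact fun h => absurd h.2 (Real.one_lt_rpow hx1 hb2).not_ge
    · rw [Set.indicator_of_notMem hx0]

lemma calibPos_one {b : ℝ} (hb : 0 < b) :
    calibPos b 1 = b * ((b + 1) * (b + 3)) * ProbabilityTheory.beta (1 / 2) (b + 2) := by
  have h1 := integral_defect_pow hb (c := 3 / 2) (by norm_num)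
  have h2 := integral_defect_pow hb (c := 5 / 2) (by norm_num)
  have hc : ∀ e : ℝ, 0 ≤ e → IntervalIntegrable (fun ρ : ℝ => ρ * (1 - ρ ^ (2 / b)) ^ e) volume 0 1 :=
    fun e he => (continuous_id.mul ((continuous_const.sub
      (Real.continuous_rpow_const (by positivity))).rpow_const fun _ => Or.inr he)).intervalIntegrable _ _
  have hI : calibPos b 1 = b * ((b + 1) * (b + 3)) *
      (4 * (∫ ρ in (0 : ℝ)..1, ρ * (1 - ρ ^ (2 / b)) ^ ((3 / 2 : ℝ) - 1)) -
        4 / 3 * ∫ ρ in (0 : ℝ)..1, ρ * (1 - ρ ^ (2 / b)) ^ ((5 / 2 : ℝ) - 1)) := by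
    rw [← intervalIntegral.integral_const_mul, ← intervalIntegral.integral_const_mul,
      ← intervalIntegral.integral_sub ((hc _ (by norm_num)).const_mul _)
        ((hc _ (by norm_num)).const_mul _), ← intervalIntegral.integral_const_mul]
    refine intervalIntegral.integral_congr fun ρ hρ => ?_
    rw [Set.uIcc_of_le zero_le_one] at hρ
    have hq : 0 ≤ 1 - ρ ^ (2 / b) := by
      linarith [Real.rpow_le_one hρ.1 hρ.2 (by positivity : 0 ≤ 2 / b)]
    have e3 : √(1 - ρ ^ (2 / b)) ^ 3 = (1 - ρ ^ (2 / b)) ^ ((5 / 2 : ℝ) - 1) := by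
      rw [Real.sqrt_eq_rpow, ← Real.rpow_natCast, ← Real.rpow_mul hq]; norm_num
    simp only [posDensity, defect]
    rw [e3, Real.sqrt_eq_rpow]
    norm_num
    ring
  rw [hI, h1, h2]
  simp only [ProbabilityTheory.beta]
  have g1 : Real.Gamma (3 / 2) = 1 / 2 * Real.Gamma (1 / 2) := by
    rw [← Real.Gamma_add_one (by norm_num)]; norm_num
  have g2 : Real.Gamma (5 / 2) = 3 / 2 * Real.Gamma (3 / 2) := by
    rw [← Real.Gamma_add_one (by norm_num)]; norm_num
  have g3 : Real.Gamma (b + 5 / 2) = (b + 3 / 2) * Real.Gamma (b + 3 / 2) := by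
    rw [← Real.Gamma_add_one (by positivity)]; ring_nf
  have g4 : Real.Gamma (b + 2) = (b + 1) * (b * Real.Gamma b) := by
    rw [← Real.Gamma_add_one hb.ne', ← Real.Gamma_add_one (by positivity)]; ring_nf
  have g5 : Real.Gamma (1 / 2 + (b + 2)) = (b + 3 / 2) * Real.Gamma (b + 3 / 2) := by
    rw [← g3]; ring_nf
  rw [g5, g4, g3, g2, g1]
  have := Real.Gamma_pos_of_pos (by positivity : 0 < b + 3 / 2)
  field_simp
  ring

lemma beta_half_eq {b : ℝ} (hb : 0 < b) :
    ProbabilityTheory.beta (1 / 2) (b + 2) = 2 ^ (2 * b + 4) *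
      (Real.Gamma ((2 * b + 4) / 2) ^ 2 / (2 * Real.Gamma (2 * b + 4))) := by
  have hd := Real.Gamma_mul_Gamma_add_half (b + 2)
  have e1 : (2 * b + 4) / 2 = b + 2 := by ring
  have e2 : 2 * b + 4 = 2 * (b + 2) := by ring
  have h1 := Real.Gamma_pos_of_pos (by positivity : 0 < b + 2)
  have h2 := Real.Gamma_pos_of_pos (by positivity : 0 < b + 2 + 1 / 2)
  have h3 := Real.Gamma_pos_of_pos (by positivity : 0 < 2 * (b + 2))
  rw [Real.rpow_sub two_pos, Real.rpow_one] at hd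
  have h4 : (0 : ℝ) < 2 ^ (2 * (b + 2)) := by positivity
  rw [e1, e2, ProbabilityTheory.beta, Real.Gamma_one_half_eq, add_comm (1 / 2) (b + 2)]
  field_simp at hd ⊢
  linarith

/-- The sharp second-order Sobolev inequality in logarithmic coordinates. -/
theorem sharp_line_inequality {b : ℝ} (hb : 0 < b) {w w1 w2 : ℝ → ℝ}
    (h0 : ∀ t, HasDerivAt w (w1 t) t) (h1 : ∀ t, HasDerivAt w1 (w2 t) t) (h2 : Continuous w2)
    (hb0 : Tendsto w atBot (nhds 0)) (hb1 : Tendsto w1 atBot (nhds 0))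
    (ht0 : Tendsto w atTop (nhds 0)) (ht1 : Tendsto w1 atTop (nhds 0))
    (hsqint : Integrable fun t => (w2 t + 2 * w1 t - b * (b + 2) * w t) ^ 2)
    (hintp : Integrable fun t => |w t| ^ (2 + 4 / b)) :
    CM (2 * b + 4) * (∫ t, |w t| ^ (2 + 4 / b)) ^ (b / (b + 2)) ≤
      ∫ t, (w2 t + 2 * w1 t - b * (b + 2) * w t) ^ 2 := by
  have hw : Continuous w := continuous_iff_continuousAt.2 fun t => (h0 t).continuousAt
  by_cases hz : ∀ t, w t = 0
  · have hp : (2 + 4 / b) ≠ 0 := by positivity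
    have hp' : b / (b + 2) ≠ 0 := by positivity
    simp only [hz, abs_zero, Real.zero_rpow hp, integral_zero, Real.zero_rpow hp', mul_zero]
    exact integral_nonneg fun t => sq_nonneg _
  push Not at hz
  obtain ⟨t₀, ht₀⟩ := hz
  obtain ⟨τ, hτ⟩ := hw.abs.exists_forall_ge' (x₀ := t₀) (by
    rw [cocompact_eq_atBot_atTop, eventually_sup]
    have hpos : (0 : ℝ) < |w t₀| := abs_pos.2 ht₀
    constructor
    · have := hb0.abs; rw [abs_zero] at this
      exact (this.eventually (gt_mem_nhds hpos)).mono fun _ h => h.le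
    · have := ht0.abs; rw [abs_zero] at this
      exact (this.eventually (gt_mem_nhds hpos)).mono fun _ h => h.le)
  have hm : 0 < |w τ| := (abs_pos.2 ht₀).trans_le (hτ t₀)
  have hmne : w τ ≠ 0 := abs_pos.1 hm
  set c := (w τ)⁻¹ with hc
  have hkey := energy_ge_normalized (w := fun t => c * w t) (w1 := fun t => c * w1 t)
    (w2 := fun t => c * w2 t) (τ := τ) hb (fun t => (h0 t).const_mul c)
    (fun t => (h1 t).const_mul c) (by fun_prop)
    (fun t => by rw [hc, abs_mul, abs_inv, inv_mul_le_one₀ hm]; exact hτ t)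
    (inv_mul_cancel₀ hmne) (by simpa using hb0.const_mul c) (by simpa using hb1.const_mul c)
    (by simpa using ht0.const_mul c) (by simpa using ht1.const_mul c)
    (by refine (hsqint.const_mul (c ^ 2)).congr (Eventually.of_forall fun t => ?_); simp only; ring)
    (by
      refine (hintp.const_mul (|c| ^ (2 + 4 / b))).congr (Eventually.of_forall fun t => ?_)
      simp only; rw [abs_mul, Real.mul_rpow (abs_nonneg _) (abs_nonneg _)])
  have e1 : ∀ t, (c * w2 t + 2 * (c * w1 t) - b * (b + 2) * (c * w t)) ^ 2 =
      c ^ 2 * (w2 t + 2 * w1 t - b * (b + 2) * w t) ^ 2 := fun t => by ring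
  have e2 : ∀ t, |c * w t| ^ (2 + 4 / b) = |c| ^ (2 + 4 / b) * |w t| ^ (2 + 4 / b) := fun t => by
    rw [abs_mul, Real.mul_rpow (abs_nonneg _) (abs_nonneg _)]
  simp only [e1, e2, integral_const_mul] at hkey
  set E := ∫ t, (w2 t + 2 * w1 t - b * (b + 2) * w t) ^ 2
  set P := ∫ t, |w t| ^ (2 + 4 / b)
  have hP : 0 ≤ P := integral_nonneg fun t => by positivity
  have hcpos : 0 < |c| := abs_pos.2 (inv_ne_zero hmne)
  set X := |c| ^ (2 + 4 / b) * P with hX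
  have hX0 : 0 ≤ X := by positivity
  set P₀ := ProbabilityTheory.beta (1 / 2) (b + 2) with hP₀
  have hP₀pos : 0 < P₀ := ProbabilityTheory.beta_pos (by norm_num) (by positivity)
  have hyoung := Real.geom_mean_le_arith_mean2_weighted (w₁ := b / (b + 2)) (w₂ := 2 / (b + 2))
    (by positivity) (by positivity) hX0 hP₀pos.le (by field_simp)
  have hCM : CM (2 * b + 4) = b * (b + 1) * (b + 2) * (b + 3) * P₀ ^ (2 / (b + 2)) := by
    rw [hP₀, beta_half_eq hb, Real.mul_rpow (by positivity)]
    · have e3 : (4 : ℝ) / (2 * b + 4) = 2 / (b + 2) := by field_simp; ring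
      rw [← Real.rpow_mul two_pos.le, CM, e3]
      have e4 : (2 * b + 4) * (2 / (b + 2)) = (4 : ℕ) := by push_cast; field_simp; ring
      rw [e4, Real.rpow_natCast]
      ring
    · have := Real.Gamma_pos_of_pos (by positivity : 0 < 2 * b + 4)
      positivity
  have hXpow : X ^ (b / (b + 2)) = c ^ 2 * P ^ (b / (b + 2)) := by
    rw [hX, Real.mul_rpow (by positivity) hP, ← Real.rpow_mul hcpos.le]
    have e5 : (2 + 4 / b) * (b / (b + 2)) = (2 : ℕ) := by push_cast; field_simp; ring
    rw [e5, Real.rpow_natCast, sq_abs]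
  rw [calibPos_one hb, ← hP₀] at hkey
  rw [hXpow] at hyoung
  have hc2 : 0 < c ^ 2 := by positivity
  have hmul := mul_le_mul_of_nonneg_left hyoung
    (by positivity : 0 ≤ b * (b + 1) * (b + 2) * (b + 3))
  have e6 : b * (b + 1) * (b + 2) * (b + 3) * (b / (b + 2) * X + 2 / (b + 2) * P₀) =
      b ^ 2 * ((b + 1) * (b + 3)) * X + 2 * (b * ((b + 1) * (b + 3)) * P₀) := by
    field_simp
  rw [e6] at hmul
  rw [hCM]
  refine le_of_mul_le_mul_left ?_ hc2
  linarith

lemma hasFDerivAt_norm_of_ne {E : Type*} [NormedAddCommGroup E] [InnerProductSpace ℝ E] {x : E}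
    (hx : x ≠ 0) : HasFDerivAt (fun y : E => ‖y‖) (‖x‖⁻¹ • innerSL ℝ x) x := by
  have hn : ‖x‖ ≠ 0 := norm_ne_zero_iff.2 hx
  have h := (hasStrictFDerivAt_norm_sq x).hasFDerivAt.sqrt (pow_ne_zero 2 hn)
  simp only [Real.sqrt_sq (norm_nonneg _)] at h
  convert h using 1
  ext v
  simp
  field_simp

/-- The weighted operator on a radial function, in terms of the profile. -/
lemma wOp_radial {N : ℕ} {α : ℝ} {u : EuclideanSpace ℝ (Fin N) → ℝ} {f f1 f2 : ℝ → ℝ}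
    (h0 : ∀ r, HasDerivAt f (f1 r) r) (h1 : ∀ r, HasDerivAt f1 (f2 r) r)
    (hu : ∀ x, u x = f ‖x‖) {x : EuclideanSpace ℝ (Fin N)} (hx : x ≠ 0) :
    wOp α u x = ‖x‖ ^ (α - 2) * (‖x‖ ^ 2 * f2 ‖x‖ + (N - 1 + α) * (‖x‖ * f1 ‖x‖)) := by
  have hn : 0 < ‖x‖ := norm_pos_iff.2 hx
  have hfd : ∀ y : EuclideanSpace ℝ (Fin N), y ≠ 0 → ∀ v,
      fderiv ℝ u y v = f1 ‖y‖ * ‖y‖⁻¹ * inner ℝ y v := by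
    intro y hy v
    have : HasFDerivAt u (f1 ‖y‖ • (‖y‖⁻¹ • innerSL ℝ y)) y := by
      rw [funext hu]
      exact (h0 ‖y‖).comp_hasFDerivAt y (hasFDerivAt_norm_of_ne hy)
    rw [this.fderiv]
    simp [mul_assoc]
  have hlap : ∀ i : Fin N, fderiv ℝ (fun y => fderiv ℝ u y (EuclideanSpace.single i 1)) x
      (EuclideanSpace.single i 1) =
      (f2 ‖x‖ * ‖x‖⁻¹ - f1 ‖x‖ / ‖x‖ ^ 2) * ‖x‖⁻¹ * x i ^ 2 + f1 ‖x‖ * ‖x‖⁻¹ := by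
    intro i
    have hev : (fun y => fderiv ℝ u y (EuclideanSpace.single i 1)) =ᶠ[nhds x]
        fun y => f1 ‖y‖ * ‖y‖⁻¹ * y i := by
      filter_upwards [isOpen_ne.mem_nhds hx] with y hy
      rw [hfd y hy]
      simp [EuclideanSpace.inner_single_right]
    rw [hev.fderiv_eq]
    have hg : HasDerivAt (fun r => f1 r * r⁻¹) (f2 ‖x‖ * ‖x‖⁻¹ + f1 ‖x‖ * (-(‖x‖ ^ 2)⁻¹)) ‖x‖ :=
      (h1 _).fun_mul (hasDerivAt_inv hn.ne')
    have hgn := hg.comp_hasFDerivAt x (hasFDerivAt_norm_of_ne hx)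
    have hp : HasFDerivAt (fun y : EuclideanSpace ℝ (Fin N) => y i)
        (EuclideanSpace.proj i : EuclideanSpace ℝ (Fin N) →L[ℝ] ℝ) x :=
      (EuclideanSpace.proj i : EuclideanSpace ℝ (Fin N) →L[ℝ] ℝ).hasFDerivAt
    have := hgn.fun_mul hp
    simp only [Function.comp_def] at this
    rw [HasFDerivAt.fderiv this]
    simp [EuclideanSpace.inner_single_right]
    ring
  have hsum : ∑ i : Fin N, x i ^ 2 = ‖x‖ ^ 2 := by
    rw [EuclideanSpace.norm_sq_eq]; simp
  unfold wOp lap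
  rw [Finset.sum_congr rfl fun i _ => hlap i, Finset.sum_add_distrib, ← Finset.mul_sum, hsum,
    hfd x hx, real_inner_self_eq_norm_sq]
  have e : ‖x‖ ^ α = ‖x‖ ^ (α - 2) * ‖x‖ ^ 2 := by
    rw [← Real.rpow_natCast, ← Real.rpow_add hn]; norm_num
  rw [e]
  simp only [Finset.sum_const, Finset.card_univ, Fintype.card_fin, nsmul_eq_mul]
  field_simp
  ring

lemma integral_Ioi_eq_integral_exp {k : ℝ} (hk : 0 < k) (g : ℝ → ℝ) :
    ∫ r in Set.Ioi (0 : ℝ), g r = ∫ t, k * rexp (k * t) * g (rexp (k * t)) := by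
  have himg : (fun t => rexp (k * t)) '' Set.univ = Set.Ioi 0 := by
    ext r
    simp only [Set.image_univ, Set.mem_range, Set.mem_Ioi]
    constructor
    · rintro ⟨t, rfl⟩; positivity
    · intro hr
      exact ⟨Real.log r / k, by rw [mul_div_cancel₀ _ hk.ne', Real.exp_log hr]⟩
  have hd : ∀ t ∈ Set.univ, HasDerivWithinAt (fun t => rexp (k * t)) (rexp (k * t) * k)
      Set.univ t := fun t _ => by
    simpa using (((hasDerivAt_id t).const_mul k).exp)
  rw [← himg, integral_image_eq_integral_abs_deriv_smul MeasurableSet.univ hd, setIntegral_univ]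
  · refine integral_congr_ae (Eventually.of_forall fun t => ?_)
    simp only [smul_eq_mul]
    rw [abs_of_pos (by positivity)]
    ring
  · intro s _ t _ hst
    have := Real.exp_injective hst
    exact mul_left_cancel₀ hk.ne' this

lemma eventually_comp_exp_eq_zero {φ : ℝ → ℝ} (hs : HasCompactSupport φ) {k : ℝ} (hk : 0 < k) :
    ∀ᶠ t in atTop, φ (rexp (k * t)) = 0 := by
  have h1 : ∀ᶠ r in atTop, φ r = 0 := by
    have := hasCompactSupport_iff_eventuallyEq.1 hs
    rw [coclosedCompact_eq_cocompact] at this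
    exact this.filter_mono atTop_le_cocompact
  exact (Real.tendsto_exp_atTop.comp (tendsto_id.const_mul_atTop hk)).eventually h1

lemma tendsto_exp_mul_comp_exp {φ : ℝ → ℝ} (hφ : Continuous φ) (hs : HasCompactSupport φ)
    {c k : ℝ} (hc : 0 < c) (hk : 0 < k) :
    Tendsto (fun t => rexp (c * t) * φ (rexp (k * t))) atBot (nhds 0) ∧
      Tendsto (fun t => rexp (c * t) * φ (rexp (k * t))) atTop (nhds 0) := by
  constructor
  · obtain ⟨C, hC⟩ := hs.exists_bound_of_continuous hφ
    have h := (Real.tendsto_exp_atBot.comp (tendsto_id.const_mul_atBot hc)).mul_const C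
    rw [zero_mul] at h
    refine squeeze_zero_norm (fun t => ?_) h
    rw [norm_mul, Real.norm_of_nonneg (Real.exp_pos _).le]
    exact mul_le_mul_of_nonneg_left (hC _) (Real.exp_pos _).le
  · refine tendsto_const_nhds.congr' ?_
    filter_upwards [eventually_comp_exp_eq_zero hs hk] with t ht
    rw [ht, mul_zero]

lemma integrable_exp_mul_comp_exp {φ : ℝ → ℝ} (hφ : Continuous φ) (hs : HasCompactSupport φ)
    {c k : ℝ} (hc : 0 < c) (hk : 0 < k) :
    Integrable fun t => rexp (c * t) * φ (rexp (k * t)) := by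
  obtain ⟨C, hC⟩ := hs.exists_bound_of_continuous hφ
  obtain ⟨T, hT⟩ := eventually_atTop.1 (eventually_comp_exp_eq_zero hs hk)
  have hdom : Integrable ((Set.Iic T).indicator fun t => rexp (c * t) * C) :=
    IntegrableOn.integrable_indicator ((integrableOn_exp_mul_Iic hc T).mul_const C) measurableSet_Iic
  refine hdom.mono' (Continuous.aestronglyMeasurable (by fun_prop)) (Eventually.of_forall fun t => ?_)
  by_cases ht : t ∈ Set.Iic T
  · rw [Set.indicator_of_mem ht, norm_mul, Real.norm_of_nonneg (Real.exp_pos _).le]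
    exact mul_le_mul_of_nonneg_left (hC _) (Real.exp_pos _).le
  · rw [Set.indicator_of_notMem ht, hT t (not_le.1 ht).le]
    simp

lemma integral_norm_eq_integral_exp {N : ℕ} (hN : 0 < N) {k : ℝ} (hk : 0 < k) (g : ℝ → ℝ) :
    ∫ x : EuclideanSpace ℝ (Fin N), g ‖x‖ =
      2 * π ^ ((N : ℝ) / 2) / Real.Gamma ((N : ℝ) / 2) *
        (k * ∫ t, rexp (k * N * t) * g (rexp (k * t))) := by
  have : Nonempty (Fin N) := ⟨⟨0, hN⟩⟩
  have hN' : (0 : ℝ) < N := by exact_mod_cast hN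
  have hvol : (N : ℝ) * volume.real (Metric.ball (0 : EuclideanSpace ℝ (Fin N)) 1) =
      2 * π ^ ((N : ℝ) / 2) / Real.Gamma ((N : ℝ) / 2) := by
    have hpi : √π ^ N = π ^ ((N : ℝ) / 2) := by
      rw [Real.sqrt_eq_rpow, ← Real.rpow_natCast, ← Real.rpow_mul pi_pos.le]
      congr 1; ring
    rw [measureReal_def, EuclideanSpace.volume_ball]
    simp only [Fintype.card_fin, ENNReal.ofReal_one, one_pow, one_mul]
    rw [ENNReal.toReal_ofReal (by
        have := Real.Gamma_pos_of_pos (show (0 : ℝ) < N / 2 + 1 by positivity)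
        positivity),
      Real.Gamma_add_one (by positivity), hpi]
    have := (Real.Gamma_pos_of_pos (show (0 : ℝ) < N / 2 by positivity)).ne'
    field_simp
  rw [integral_fun_norm_addHaar volume g, finrank_euclideanSpace_fin,
    integral_Ioi_eq_integral_exp hk, ← hvol, ← integral_const_mul]
  simp only [nsmul_eq_mul, smul_eq_mul]
  rw [mul_assoc]
  congr 3
  funext t
  obtain ⟨n, rfl⟩ : ∃ n, N = n + 1 := ⟨N - 1, by omega⟩
  have : rexp (k * ↑(n + 1) * t) = rexp (k * t) * rexp (k * t) ^ n := by
    rw [← Real.exp_nat_mul, ← Real.exp_add]; push_cast; congr 1; ring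
  rw [this, Nat.add_sub_cancel]
  ring

lemma hasDerivAt_exp_mul_comp_exp {φ φ1 : ℝ → ℝ} (h : ∀ r, HasDerivAt φ (φ1 r) r) (b k t : ℝ) :
    HasDerivAt (fun t => rexp (b * t) * φ (rexp (k * t)))
      (rexp (b * t) * (b * φ (rexp (k * t)) + k * (rexp (k * t) * φ1 (rexp (k * t))))) t := by
  have he : ∀ c : ℝ, HasDerivAt (fun t => rexp (c * t)) (rexp (c * t) * c) t := fun c => by
    simpa using ((hasDerivAt_id t).const_mul c).exp
  refine ((he b).fun_mul ((h (rexp (k * t))).comp t (he k))).congr_deriv ?_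
  simp only [Function.comp_apply]
  ring

/-- the sharp radial weighted second-order Sobolev inequality with explicit
constant `S^{rad}_{N,α}`. Note `2/2**_α = (N−4+2α)/N`. -/
theorem stmt3 (N : ℕ) (hN : 2 ≤ N) (α : ℝ) (hα1 : ((4 : ℝ) - N)/2 < α) (hα2 : α < 2)
    (u : EuclideanSpace ℝ (Fin N) → ℝ) (hu : ContDiff ℝ (⊤ : ℕ∞) u) (hsupp : HasCompactSupport u)
    (hrad : ∀ x y : EuclideanSpace ℝ (Fin N), ‖x‖ = ‖y‖ → u x = u y) :
    (∫ x, (wOp α u x)^2) ≥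
      Srad N α * (∫ x, |u x| ^ (pexp N α)) ^ (((N : ℝ) - 4 + 2*α)/(N : ℝ)) := by
  have hN0 : 0 < N := by omega
  have hNr : (0 : ℝ) < N := by exact_mod_cast hN0
  have hd : 0 < 2 - α := by linarith
  have hm : 0 < (N : ℝ) - 4 + 2 * α := by linarith
  set b : ℝ := ((N : ℝ) - 4 + 2 * α) / (2 - α) with hbdef
  set k : ℝ := 2 / (2 - α) with hkdef
  have hb : 0 < b := by positivity
  have hk : 0 < k := by positivity
  have hbk : 2 * b = k * (N - 4 + 2 * α) := by rw [hbdef, hkdef]; ring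
  have hkα : k * (2 - α) = 2 := by rw [hkdef]; field_simp
  have hkN : k * N = 2 * b + 4 := by linear_combination 2 * hkα - hbk
  have hp : pexp N α = 2 + 4 / b := by
    rw [pexp, hbdef]; field_simp; ring
  have hθ : ((N : ℝ) - 4 + 2 * α) / N = b / (b + 2) := by
    rw [div_eq_div_iff hNr.ne' (by positivity)]
    apply mul_left_cancel₀ hk.ne'
    linear_combination (-(b + 2)) * hbk - b * hkN
  -- the radial profile
  set e : EuclideanSpace ℝ (Fin N) := EuclideanSpace.single ⟨0, hN0⟩ 1 with hedef
  have he : ‖e‖ = 1 := by simp [hedef]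
  set f : ℝ → ℝ := fun r => u (r • e) with hf
  have hfs : ContDiff ℝ (⊤ : ℕ∞) f := hu.comp (contDiff_id.smul contDiff_const)
  have huf : ∀ x, u x = f ‖x‖ := fun x => hrad _ _ (by rw [norm_smul, he]; simp)
  have hf1s : ContDiff ℝ (⊤ : ℕ∞) (deriv f) := (contDiff_infty_iff_deriv.1 hfs).2
  have hf2s : ContDiff ℝ (⊤ : ℕ∞) (deriv (deriv f)) := (contDiff_infty_iff_deriv.1 hf1s).2
  have h0 : ∀ r, HasDerivAt f (deriv f r) r := fun r =>
    (hfs.differentiable (by simp) r).hasDerivAt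
  have h1 : ∀ r, HasDerivAt (deriv f) (deriv (deriv f) r) r := fun r =>
    (hf1s.differentiable (by simp) r).hasDerivAt
  have hfc : HasCompactSupport f := by
    refine hsupp.comp_isClosedEmbedding (Isometry.isClosedEmbedding ?_)
    refine Isometry.of_dist_eq fun r s => ?_
    rw [dist_eq_norm, ← sub_smul, norm_smul, he, mul_one, dist_eq_norm]
  have hf1c := hfc.deriv
  have hf2c := hf1c.deriv
  have c0 := hfs.continuous
  have c1 := hf1s.continuous
  have c2 := hf2s.continuous
  set f1 := deriv f with hf1
  set f2 := deriv f1 with hf2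
  -- logarithmic coordinates
  set φ1 : ℝ → ℝ := fun r => b * f r + k * (r * f1 r) with hφ1
  set φ2 : ℝ → ℝ := fun r => b * f1 r + k * (f1 r + r * f2 r) with hφ2
  have hφ : ∀ r, HasDerivAt φ1 (φ2 r) r := fun r => by
    have := ((h0 r).const_mul b).fun_add (((hasDerivAt_id r).fun_mul (h1 r)).const_mul k)
    simpa [hφ1, hφ2] using this
  have cφ1 : Continuous φ1 := by fun_prop
  have cφ2 : Continuous φ2 := by fun_prop
  have sφ1 : HasCompactSupport φ1 :=
    (hfc.mul_left (f := fun _ => b)).add ((hf1c.mul_left (f := id)).mul_left (f := fun _ => k))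
  set D : ℝ → ℝ := fun r => r ^ 2 * f2 r + (N - 1 + α) * (r * f1 r) with hD
  have cD : Continuous D := by fun_prop
  have sD : HasCompactSupport D :=
    (hf2c.mul_left (f := fun r => r ^ 2)).add
      ((hf1c.mul_left (f := id)).mul_left (f := fun _ => (N : ℝ) - 1 + α))
  have sD2 : HasCompactSupport fun r => D r ^ 2 := 
    sD.comp_left (g := fun y => y ^ 2) (by simp)
  set w : ℝ → ℝ := fun t => rexp (b * t) * f (rexp (k * t)) with hw
  set w1 : ℝ → ℝ := fun t => rexp (b * t) * φ1 (rexp (k * t)) with hw1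
  set w2 : ℝ → ℝ := fun t => rexp (b * t) * (b * φ1 (rexp (k * t)) +
    k * (rexp (k * t) * φ2 (rexp (k * t)))) with hw2
  have hop : ∀ t, (w2 t + 2 * w1 t - b * (b + 2) * w t) ^ 2 =
      k ^ 4 * (rexp (2 * b * t) * D (rexp (k * t)) ^ 2) := fun t => by
    have hE : rexp (2 * b * t) = rexp (b * t) ^ 2 := by
      rw [← Real.exp_nat_mul]; congr 1; push_cast; ring
    have : w2 t + 2 * w1 t - b * (b + 2) * w t = k ^ 2 * (rexp (b * t) * D (rexp (k * t))) := by
      simp only [hw, hw1, hw2, hφ1, hφ2, hD]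
      linear_combination (k * rexp (b * t) * rexp (k * t) * f1 (rexp (k * t))) *
        (hbk - hkα)
    rw [this, hE]; ring
  have hwp : ∀ t, |w t| ^ (2 + 4 / b) = rexp (k * N * t) * |f (rexp (k * t))| ^ (2 + 4 / b) :=
    fun t => by
    rw [hw, abs_mul, abs_of_pos (Real.exp_pos _), Real.mul_rpow (Real.exp_pos _).le (abs_nonneg _),
      ← Real.exp_mul, hkN]
    congr 2
    field_simp
  have hpow : 2 + 4 / b ≠ 0 := by positivity
  have sfp : HasCompactSupport fun r => |f r| ^ (2 + 4 / b) :=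
    hfc.comp_left (g := fun y => |y| ^ (2 + 4 / b)) (by simp [Real.zero_rpow hpow])
  have cfp : Continuous fun r => |f r| ^ (2 + 4 / b) :=
    c0.abs.rpow_const fun _ => Or.inr (by positivity)
  have key := sharp_line_inequality hb (w := w) (w1 := w1) (w2 := w2)
    (hasDerivAt_exp_mul_comp_exp h0 b k) (hasDerivAt_exp_mul_comp_exp hφ b k) (by fun_prop)
    (tendsto_exp_mul_comp_exp c0 hfc hb hk).1 (tendsto_exp_mul_comp_exp cφ1 sφ1 hb hk).1
    (tendsto_exp_mul_comp_exp c0 hfc hb hk).2 (tendsto_exp_mul_comp_exp cφ1 sφ1 hb hk).2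
    (by
      simp only [hop]
      exact (integrable_exp_mul_comp_exp (cD.pow 2) sD2 (by positivity) hk).const_mul _)
    (by
      simp only [hwp]
      exact integrable_exp_mul_comp_exp cfp sfp (by positivity) hk)
  -- both integrals in logarithmic coordinates
  set σ : ℝ := 2 * π ^ ((N : ℝ) / 2) / Real.Gamma ((N : ℝ) / 2) with hσdef
  have hσ : 0 < σ := by
    have := Real.Gamma_pos_of_pos (show (0 : ℝ) < N / 2 by positivity)
    positivity
  set P : ℝ := ∫ t, |w t| ^ (2 + 4 / b) with hP
  set E : ℝ := ∫ t, (w2 t + 2 * w1 t - b * (b + 2) * w t) ^ 2 with hE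
  have hP0 : 0 ≤ P := integral_nonneg fun t => by positivity
  have hI1 : ∫ x, |u x| ^ (pexp N α) = σ * (k * P) := by
    simp only [hp, huf]
    rw [integral_norm_eq_integral_exp hN0 hk fun r => |f r| ^ (2 + 4 / b), hP, ← hσdef]
    simp only [hwp]
  have hI2 : ∫ x, (wOp α u x) ^ 2 = σ * (k * ((k ^ 4)⁻¹ * E)) := by
    have : Nonempty (Fin N) := ⟨⟨0, hN0⟩⟩
    have hae : (fun x => (wOp α u x) ^ 2) =ᵐ[volume]
        fun x : EuclideanSpace ℝ (Fin N) => (‖x‖ ^ (α - 2) * D ‖x‖) ^ 2 := by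
      filter_upwards [Measure.ae_ne volume 0] with x hx
      rw [wOp_radial h0 h1 huf hx]
    rw [integral_congr_ae hae,
      integral_norm_eq_integral_exp hN0 hk fun r => (r ^ (α - 2) * D r) ^ 2, hE,
      ← hσdef, ← integral_const_mul (k ^ 4)⁻¹]
    congr 3
    funext t
    rw [hop, inv_mul_cancel_left₀ (by positivity), mul_pow, ← Real.exp_mul, ← Real.exp_nat_mul,
      ← mul_assoc, ← Real.exp_add]
    congr 2
    push_cast
    linear_combination (-t) * hbk
  have hM : 2 * (N : ℝ) / (2 - α) = 2 * b + 4 := by rw [← hkN, hkdef]; ring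
  have h1θ : (4 - 2 * α) / (N : ℝ) = 1 - b / (b + 2) := by
    rw [← hθ]; field_simp; ring
  have hkinv : (2 - α) / 2 = k⁻¹ := by rw [hkdef, inv_div]
  rw [hI1, hI2, hθ, Srad, ← hσdef, hM, h1θ, hkinv, ge_iff_le]
  set θ := b / (b + 2)
  rw [Real.mul_rpow hσ.le (by positivity), Real.mul_rpow hk.le hP0]
  have e1 : σ ^ (1 - θ) * σ ^ θ = σ := by rw [← Real.rpow_add hσ]; simp
  have e2 : k⁻¹ ^ (4 - (1 - θ)) * k ^ θ = k * (k ^ 4)⁻¹ := by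
    rw [Real.inv_rpow hk.le, ← Real.rpow_neg hk.le, ← Real.rpow_add hk]
    have : -(4 - (1 - θ)) + θ = 1 - (4 : ℕ) := by push_cast; ring
    rw [this, Real.rpow_sub hk, Real.rpow_one, Real.rpow_natCast, div_eq_mul_inv]
  calc _ = (σ ^ (1 - θ) * σ ^ θ) * ((k⁻¹ ^ (4 - (1 - θ)) * k ^ θ) * (CM (2 * b + 4) * P ^ θ)) := by
        ring
    _ = σ * ((k * (k ^ 4)⁻¹) * (CM (2 * b + 4) * P ^ θ)) := by rw [e1, e2]
    _ ≤ σ * ((k * (k ^ 4)⁻¹) * E) := by gcongr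
    _ = _ := by ring

end
end

section
/- Let N ≥ 2 be an integer and let α be a real number with (4−N)/2 < α < 2. Then the extremal function U_{1,α}(x) = C_{N,α}(1+|x|^{2−α})^{−(N−4+2α)/(2−α)} achieves equality in the radial inequality: ∫_{ℝ^N} |div(|x|^α ∇U_{1,α})(x)|² dx = S^{rad}_{N,α} (∫_{ℝ^N} U_{1,α}(x)^{2**_α} dx)^{2/2**_α}, and both integrals are finite. -/
open Real MeasureTheory Filter

noncomputable section

/-- Euler's beta integral over the unit interval. -/
theorem integrableOn_and_integral_beta_Ioo {a b : ℝ} (ha : 0 < a) (hb : 0 < b) :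
    IntegrableOn (fun x : ℝ => x ^ (a - 1) * (1 - x) ^ (b - 1)) (Set.Ioo 0 1) ∧
    ∫ x in Set.Ioo (0 : ℝ) 1, x ^ (a - 1) * (1 - x) ^ (b - 1)
      = Gamma a * Gamma b / Gamma (a + b) := by
  have hB : 0 < ProbabilityTheory.beta a b := ProbabilityTheory.beta_pos ha hb
  set f : ℝ → ℝ := fun x => x ^ (a - 1) * (1 - x) ^ (b - 1) with hf
  have hmeas : Measurable f := by fun_prop
  have hnn : 0 ≤ᵐ[volume.restrict (Set.Ioo (0 : ℝ) 1)] f := by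
    filter_upwards [ae_restrict_mem measurableSet_Ioo] with x hx
    exact mul_nonneg (rpow_nonneg hx.1.le _) (rpow_nonneg (by linarith [hx.2]) _)
  have hone := ProbabilityTheory.lintegral_betaPDF_eq_one ha hb
  rw [ProbabilityTheory.lintegral_betaPDF] at hone
  have hlin : ∫⁻ x in Set.Ioo (0 : ℝ) 1, ENNReal.ofReal (f x)
      = ENNReal.ofReal (ProbabilityTheory.beta a b) := by
    have h2 : ∀ x, ENNReal.ofReal (1 / ProbabilityTheory.beta a b * x ^ (a - 1) * (1 - x) ^ (b - 1))
        = ENNReal.ofReal (1 / ProbabilityTheory.beta a b) * ENNReal.ofReal (f x) := by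
      intro x
      rw [mul_assoc, ENNReal.ofReal_mul (by positivity)]
    simp_rw [h2] at hone
    rw [lintegral_const_mul _ (by fun_prop)] at hone
    calc _ = ENNReal.ofReal (ProbabilityTheory.beta a b) *
        (ENNReal.ofReal (1 / ProbabilityTheory.beta a b) *
          ∫⁻ x in Set.Ioo (0 : ℝ) 1, ENNReal.ofReal (f x)) := by
          rw [← mul_assoc, ← ENNReal.ofReal_mul hB.le, mul_one_div_cancel hB.ne',
            ENNReal.ofReal_one, one_mul]
      _ = _ := by rw [hone, mul_one]
  refine ⟨⟨hmeas.aestronglyMeasurable, ?_⟩, ?_⟩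
  · rw [hasFiniteIntegral_iff_ofReal hnn, hlin]
    exact ENNReal.ofReal_lt_top
  · rw [integral_eq_lintegral_of_nonneg_ae hnn hmeas.aestronglyMeasurable, hlin,
      ENNReal.toReal_ofReal hB.le, ProbabilityTheory.beta]

theorem image_div_one_add_Ioi :
    (fun t : ℝ => t / (1 + t)) '' Set.Ioi 0 = Set.Ioo 0 1 := by
  ext x
  constructor
  · rintro ⟨t, ht, rfl⟩
    have ht : 0 < t := ht
    exact ⟨by positivity, by rw [div_lt_one (by positivity)]; linarith⟩
  · rintro ⟨h0, h1⟩
    have : 0 < 1 - x := by linarith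
    exact ⟨x / (1 - x), by simp only [Set.mem_Ioi]; positivity, by field_simp; ring⟩

/-- Euler's beta integral over the half-line. -/
theorem integrableOn_and_integral_beta_Ioi {a b : ℝ} (ha : 0 < a) (hb : 0 < b) :
    IntegrableOn (fun t : ℝ => t ^ (a - 1) * (1 + t) ^ (-(a + b))) (Set.Ioi 0) ∧
    ∫ t in Set.Ioi (0 : ℝ), t ^ (a - 1) * (1 + t) ^ (-(a + b))
      = Gamma a * Gamma b / Gamma (a + b) := by
  have hd : ∀ t ∈ Set.Ioi (0 : ℝ), HasDerivWithinAt (fun t : ℝ => t / (1 + t))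
      (1 / (1 + t) ^ 2) (Set.Ioi 0) t := by
    intro t ht
    have ht : 0 < t := ht
    have h := (hasDerivAt_id t).div ((hasDerivAt_id t).const_add 1) (by simp; positivity)
    refine (h.congr_deriv ?_).hasDerivWithinAt
    simp
  have hinj : Set.InjOn (fun t : ℝ => t / (1 + t)) (Set.Ioi 0) := by
    intro s hs t ht h
    have hs : 0 < s := hs
    have ht : 0 < t := ht
    simp only at h
    field_simp at h
    linarith
  have hcongr : Set.EqOn (fun t : ℝ => |1 / (1 + t) ^ 2| •
      ((t / (1 + t)) ^ (a - 1) * (1 - t / (1 + t)) ^ (b - 1)))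
      (fun t : ℝ => t ^ (a - 1) * (1 + t) ^ (-(a + b))) (Set.Ioi 0) := by
    intro t ht
    have ht : 0 < t := ht
    have h1 : 0 < 1 + t := by linarith
    have h2 : 1 - t / (1 + t) = (1 + t)⁻¹ := by field_simp; ring
    have h3 : (1 + t) ^ (-(a + b)) = ((1 + t) ^ 2)⁻¹ * (((1 + t) ^ (a - 1))⁻¹ *
        ((1 + t) ^ (b - 1))⁻¹) := by
      rw [← rpow_neg h1.le, ← rpow_neg h1.le, ← rpow_natCast, ← rpow_neg h1.le,
        ← rpow_add h1, ← rpow_add h1]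
      congr 1
      push_cast
      ring
    simp only [smul_eq_mul]
    rw [abs_of_pos (by positivity), h2, div_rpow ht.le h1.le, inv_rpow h1.le, h3]
    ring
  obtain ⟨hi, hv⟩ := integrableOn_and_integral_beta_Ioo ha hb
  rw [← image_div_one_add_Ioi] at hi hv
  rw [integrableOn_image_iff_integrableOn_abs_deriv_smul measurableSet_Ioi hd hinj] at hi
  rw [integral_image_eq_integral_abs_deriv_smul measurableSet_Ioi hd hinj] at hv
  exact ⟨(integrableOn_congr_fun hcongr measurableSet_Ioi).1 hi,
    by rw [← hv, setIntegral_congr_fun measurableSet_Ioi hcongr]⟩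

/-- The surface area of the unit sphere of `ℝ^N`. -/
theorem card_mul_volume_real_ball {N : ℕ} (hN : N ≠ 0) :
    (N : ℝ) * volume.real (Metric.ball (0 : EuclideanSpace ℝ (Fin N)) 1)
      = 2 * π ^ ((N : ℝ) / 2) / Gamma ((N : ℝ) / 2) := by
  have : Nonempty (Fin N) := Fin.pos_iff_nonempty.1 (Nat.pos_of_ne_zero hN)
  have hN' : 0 < (N : ℝ) := by exact_mod_cast Nat.pos_of_ne_zero hN
  have hG := Gamma_pos_of_pos (half_pos hN')
  rw [measureReal_def, EuclideanSpace.volume_ball]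
  simp only [ENNReal.ofReal_one, one_pow, Fintype.card_fin, one_mul]
  rw [ENNReal.toReal_ofReal (by positivity), Gamma_add_one (by positivity), sqrt_eq_rpow,
    ← rpow_natCast, ← rpow_mul pi_pos.le]
  have : 1 / 2 * (N : ℝ) = N / 2 := by ring
  rw [this]
  field_simp

/-- Polar coordinates followed by the substitution `t = r ^ γ`. -/
theorem integrable_and_integral_norm_rpow {N : ℕ} (hN : N ≠ 0) {γ : ℝ} (hγ : 0 < γ) {F : ℝ → ℝ}
    (hF : IntegrableOn (fun t => t ^ ((N : ℝ) / γ - 1) * F t) (Set.Ioi 0)) :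
    Integrable (fun x : EuclideanSpace ℝ (Fin N) => F (‖x‖ ^ γ)) ∧
    ∫ x : EuclideanSpace ℝ (Fin N), F (‖x‖ ^ γ)
      = 2 * π ^ ((N : ℝ) / 2) / Gamma ((N : ℝ) / 2) / γ *
        ∫ t in Set.Ioi 0, t ^ ((N : ℝ) / γ - 1) * F t := by
  have : Nontrivial (EuclideanSpace ℝ (Fin N)) := by
    have : Nonempty (Fin N) := Fin.pos_iff_nonempty.1 (Nat.pos_of_ne_zero hN)
    infer_instance
  have hcongr : Set.EqOn (fun y : ℝ => (|γ| * y ^ (γ - 1)) •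
      ((y ^ γ) ^ ((N : ℝ) / γ - 1) * F (y ^ γ)))
      (fun y : ℝ => γ * (y ^ (N - 1) • F (y ^ γ))) (Set.Ioi 0) := by
    intro y hy
    have hy : 0 < y := hy
    have h : y ^ (N - 1) = y ^ (γ - 1) * y ^ (γ * ((N : ℝ) / γ - 1)) := by
      rw [← rpow_add hy, ← rpow_natCast, Nat.cast_sub (Nat.one_le_iff_ne_zero.2 hN)]
      congr 1
      field_simp
      push_cast
      ring
    simp only [smul_eq_mul]
    rw [abs_of_pos hγ, ← rpow_mul hy.le, h]
    ring
  have hi := (integrableOn_Ioi_comp_rpow_iff _ hγ.ne').2 hF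
  rw [integrableOn_congr_fun hcongr measurableSet_Ioi] at hi
  have hv := integral_comp_rpow_Ioi (fun t => t ^ ((N : ℝ) / γ - 1) * F t) hγ.ne'
  rw [setIntegral_congr_fun measurableSet_Ioi hcongr, integral_const_mul] at hv
  constructor
  · refine (integrable_fun_norm_addHaar (f := fun r => F (r ^ γ)) volume).2 ?_
    rw [finrank_euclideanSpace_fin]
    refine (hi.const_mul γ⁻¹).congr (Eventually.of_forall fun y => ?_)
    simp only
    rw [inv_mul_cancel_left₀ hγ.ne']
  · rw [integral_fun_norm_addHaar volume (fun r => F (r ^ γ)), finrank_euclideanSpace_fin, ← hv,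
      ← card_mul_volume_real_ball hN]
    simp only [smul_eq_mul, nsmul_eq_mul]
    field_simp

theorem hasFDerivAt_comp_norm_sq {E : Type*} [NormedAddCommGroup E] [InnerProductSpace ℝ E]
    {h : ℝ → ℝ} {d : ℝ} {x : E} (hh : HasDerivAt h d (‖x‖ ^ 2)) :
    HasFDerivAt (fun y : E => h (‖y‖ ^ 2)) (d • (2 • innerSL ℝ x)) x :=
  hh.comp_hasFDerivAt x (hasStrictFDerivAt_norm_sq x).hasFDerivAt

theorem fderiv_comp_norm_sq_apply {E : Type*} [NormedAddCommGroup E] [InnerProductSpace ℝ E]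
    {h : ℝ → ℝ} {d : ℝ} {x : E} (hh : HasDerivAt h d (‖x‖ ^ 2)) (v : E) :
    fderiv ℝ (fun y : E => h (‖y‖ ^ 2)) x v = 2 * d * inner ℝ x v := by
  rw [(hasFDerivAt_comp_norm_sq hh).fderiv]
  simp
  ring

/-- The Laplacian of a function of `‖y‖ ^ 2`. -/
theorem lap_comp_norm_sq {N : ℕ} {h h' : ℝ → ℝ} {d : ℝ} {x : EuclideanSpace ℝ (Fin N)}
    (hx : x ≠ 0) (hh : ∀ q : ℝ, 0 < q → HasDerivAt h (h' q) q)
    (hh' : HasDerivAt h' d (‖x‖ ^ 2)) :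
    lap (fun y => h (‖y‖ ^ 2)) x = 4 * ‖x‖ ^ 2 * d + 2 * N * h' (‖x‖ ^ 2) := by
  have key : ∀ i : Fin N, fderiv ℝ (fun y => fderiv ℝ
      (fun y : EuclideanSpace ℝ (Fin N) => h (‖y‖ ^ 2)) y (EuclideanSpace.single i 1)) x
      (EuclideanSpace.single i 1) = 4 * d * x i ^ 2 + 2 * h' (‖x‖ ^ 2) := by
    intro i
    have hev : (fun y => fderiv ℝ (fun y : EuclideanSpace ℝ (Fin N) => h (‖y‖ ^ 2)) y
        (EuclideanSpace.single i 1)) =ᶠ[nhds x]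
        fun y => h' (‖y‖ ^ 2) * (2 * EuclideanSpace.proj (𝕜 := ℝ) i y) := by
      filter_upwards [isOpen_ne.mem_nhds hx] with y hy
      rw [fderiv_comp_norm_sq_apply (hh _ (by have := norm_pos_iff.2 hy; positivity))]
      simp [EuclideanSpace.inner_single_right]
      ring
    rw [hev.fderiv_eq]
    have hp : HasFDerivAt (fun y : EuclideanSpace ℝ (Fin N) =>
        2 * EuclideanSpace.proj (𝕜 := ℝ) i y)
        ((2 : ℝ) • (EuclideanSpace.proj i : EuclideanSpace ℝ (Fin N) →L[ℝ] ℝ)) x :=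
      (EuclideanSpace.proj i : EuclideanSpace ℝ (Fin N) →L[ℝ] ℝ).hasFDerivAt.const_mul 2
    rw [((hasFDerivAt_comp_norm_sq hh').fun_mul hp).fderiv]
    simp [EuclideanSpace.inner_single_right]
    ring
  rw [lap, Finset.sum_congr rfl fun i _ => key i, Finset.sum_add_distrib, ← Finset.mul_sum,
    ← EuclideanSpace.real_norm_sq_eq]
  simp
  ring

/-- The weighted operator applied to `U_{1,α}`, away from the origin. -/
theorem wOp_Usol_one {N : ℕ} {α : ℝ} (hα : α < 2) {x : EuclideanSpace ℝ (Fin N)} (hx : x ≠ 0) :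
    wOp α (Usol N α 1) x = -(Cconst N α * (N - 4 + 2 * α) * (2 - α)) *
      ((1 + ‖x‖ ^ (2 - α)) ^ (-((N : ℝ) / (2 - α))) * (N / (2 - α) + ‖x‖ ^ (2 - α))) := by
  set C := Cconst N α
  set m := ((N : ℝ) - 4 + 2 * α) / (2 - α) with hm
  have hγ : 0 < 2 - α := by linarith
  set β := (2 - α) / 2 with hβ
  have hr : 0 < ‖x‖ := norm_pos_iff.2 hx
  have hpow : ∀ r : ℝ, 0 ≤ r → (r ^ 2) ^ β = r ^ (2 - α) := by
    intro r hr
    rw [← rpow_natCast, ← rpow_mul hr]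
    congr 1
    rw [hβ]
    push_cast
    ring
  have hU : Usol N α 1 = fun y => (fun q : ℝ => C * (1 + q ^ β) ^ (-m)) (‖y‖ ^ 2) := by
    ext y
    simp only [Usol, one_rpow, mul_one, one_mul, hpow _ (norm_nonneg y)]
    rfl
  have h1 : ∀ q : ℝ, 0 < q → HasDerivAt (fun q : ℝ => C * (1 + q ^ β) ^ (-m))
      (-(C * m * β) * (q ^ (β - 1) * (1 + q ^ β) ^ (-m - 1))) q := by
    intro q hq
    have := (((hasDerivAt_rpow_const (p := β) (Or.inl hq.ne')).const_add 1).rpow_const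
      (p := -m) (Or.inl (by positivity))).const_mul C
    refine this.congr_deriv ?_
    ring
  have h2 : ∀ q : ℝ, 0 < q → HasDerivAt
      (fun q : ℝ => -(C * m * β) * (q ^ (β - 1) * (1 + q ^ β) ^ (-m - 1)))
      (-(C * m * β) * ((β - 1) * q ^ (β - 1 - 1) * (1 + q ^ β) ^ (-m - 1) +
        q ^ (β - 1) * (β * q ^ (β - 1) * (-m - 1) * (1 + q ^ β) ^ (-m - 1 - 1)))) q := by
    intro q hq
    exact ((hasDerivAt_rpow_const (p := β - 1) (Or.inl hq.ne')).mul
      (((hasDerivAt_rpow_const (p := β) (Or.inl hq.ne')).const_add 1).rpow_const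
      (p := -m - 1) (Or.inl (by positivity)))).const_mul _
  have hq : 0 < ‖x‖ ^ 2 := by positivity
  have hfd := fderiv_comp_norm_sq_apply (h1 _ hq) x
  have hlap := lap_comp_norm_sq hx h1 (h2 _ hq)
  rw [wOp, hU, hfd, hlap, real_inner_self_eq_norm_sq]
  have e1 : (‖x‖ ^ 2) ^ (β - 1 - 1) = ‖x‖ ^ (2 - α) / ‖x‖ ^ 4 := by
    rw [rpow_sub_one hq.ne', rpow_sub_one hq.ne', hpow _ hr.le]
    field_simp
  have e2 : (‖x‖ ^ 2) ^ (β - 1) = ‖x‖ ^ (2 - α) / ‖x‖ ^ 2 := by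
    rw [rpow_sub_one hq.ne', hpow _ hr.le]
  have e3 : ‖x‖ ^ α = ‖x‖ ^ 2 / ‖x‖ ^ (2 - α) := by
    rw [eq_div_iff (by positivity), ← rpow_add hr, ← rpow_natCast]
    congr 1
    push_cast
    ring
  have e4 : ‖x‖ ^ (α - 2) = 1 / ‖x‖ ^ (2 - α) := by
    rw [one_div, ← rpow_neg hr.le]
    congr 1
    ring
  simp only [e1, e2, e3, e4, hpow _ hr.le]
  have ht : 0 < ‖x‖ ^ (2 - α) := by positivity
  generalize ‖x‖ ^ (2 - α) = t at ht
  have h1t : 0 < 1 + t := by linarith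
  have e5 : -((N : ℝ) / (2 - α)) = -m - 1 - 1 := by
    rw [hm]
    field_simp
    ring
  have e6 : (1 + t) ^ (-m - 1) = (1 + t) ^ (-m - 1 - 1) * (1 + t) := by
    rw [rpow_sub_one h1t.ne' (-m - 1)]
    field_simp
  rw [e5, e6]
  generalize (1 + t) ^ (-m - 1 - 1) = w
  rw [hm, hβ]
  field_simp
  ring

theorem integrableOn_and_integral_extremal_energy {K : ℝ} (hK : 2 < K) :
    IntegrableOn (fun t : ℝ => t ^ (K - 1) * ((1 + t) ^ (-K) * (K + t)) ^ 2) (Set.Ioi 0) ∧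
    ∫ t in Set.Ioi (0 : ℝ), t ^ (K - 1) * ((1 + t) ^ (-K) * (K + t)) ^ 2
      = K * (K - 1) * (K + 1) / (K - 2) * (Gamma K * Gamma K / Gamma (K + K)) := by
  obtain ⟨i0, v0⟩ := integrableOn_and_integral_beta_Ioi (a := K) (b := K) (by linarith)
    (by linarith)
  obtain ⟨i1, v1⟩ := integrableOn_and_integral_beta_Ioi (a := K + 1) (b := K - 1) (by linarith)
    (by linarith)
  obtain ⟨i2, v2⟩ := integrableOn_and_integral_beta_Ioi (a := K + 2) (b := K - 2) (by linarith)
    (by linarith)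
  have hcongr : Set.EqOn (fun t : ℝ => K ^ 2 * (t ^ (K - 1) * (1 + t) ^ (-(K + K))) +
      2 * K * (t ^ (K + 1 - 1) * (1 + t) ^ (-(K + 1 + (K - 1)))) +
      t ^ (K + 2 - 1) * (1 + t) ^ (-(K + 2 + (K - 2))))
      (fun t : ℝ => t ^ (K - 1) * ((1 + t) ^ (-K) * (K + t)) ^ 2) (Set.Ioi 0) := by
    intro t ht
    have ht : 0 < t := ht
    have h1t : 0 < 1 + t := by linarith
    have e1 : K + 1 - 1 = K - 1 + 1 := by ring
    have e2 : K + 2 - 1 = K - 1 + 1 + 1 := by ring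
    have e3 : -(K + 1 + (K - 1)) = -K + -K := by ring
    have e4 : -(K + 2 + (K - 2)) = -K + -K := by ring
    have e5 : -(K + K) = -K + -K := by ring
    simp only
    rw [e1, e2, e3, e4, e5, rpow_add_one ht.ne' (K - 1 + 1),
      rpow_add_one ht.ne' (K - 1), rpow_add h1t]
    ring
  have j1 := (i0.const_mul (K ^ 2)).fun_add (i1.const_mul (2 * K))
  refine ⟨(integrableOn_congr_fun hcongr measurableSet_Ioi).1 (j1.fun_add i2), ?_⟩
  rw [← setIntegral_congr_fun measurableSet_Ioi hcongr, integral_add j1 i2,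
    integral_add (i0.const_mul (K ^ 2)) (i1.const_mul (2 * K)), integral_const_mul,
    integral_const_mul, v0, v1, v2]
  have g1 : Gamma K = (K - 1) * ((K - 2) * Gamma (K - 2)) := by
    rw [← Gamma_add_one (by linarith : K - 2 ≠ 0), show K - 2 + 1 = K - 1 by ring,
      ← Gamma_add_one (by linarith : K - 1 ≠ 0), sub_add_cancel]
  have g2 : Gamma (K - 1) = (K - 2) * Gamma (K - 2) := by
    rw [← Gamma_add_one (by linarith : K - 2 ≠ 0), show K - 2 + 1 = K - 1 by ring]
  have g3 : Gamma (K + 1) = K * Gamma K := Gamma_add_one (by linarith)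
  have g4 : Gamma (K + 2) = (K + 1) * (K * Gamma K) := by
    rw [← g3, ← Gamma_add_one (by linarith : K + 1 ≠ 0), show K + 1 + 1 = K + 2 by ring]
  rw [show K + 1 + (K - 1) = K + K by ring, show K + 2 + (K - 2) = K + K by ring, g3, g4, g2, g1]
  have : K - 2 ≠ 0 := by linarith
  field_simp
  ring

/-- The radial constant in terms of the sphere area and the beta integral. -/
theorem Srad_eq {N : ℕ} (hN : N ≠ 0) {α : ℝ} (hα : α < 2) :
    Srad N α = ((N : ℝ) - 4 + 2 * α) * ((N : ℝ) - 2 + α) * (N : ℝ) * ((N : ℝ) + 2 - α) *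
      (2 * π ^ ((N : ℝ) / 2) / Gamma ((N : ℝ) / 2) / (2 - α) *
        (Gamma (N / (2 - α)) * Gamma (N / (2 - α)) / Gamma (N / (2 - α) + N / (2 - α)))) ^
          ((4 - 2 * α) / N) := by
  have hN' : 0 < (N : ℝ) := by exact_mod_cast Nat.pos_of_ne_zero hN
  have hγ : 0 < 2 - α := by linarith
  have hω : 0 < 2 * π ^ ((N : ℝ) / 2) / Gamma ((N : ℝ) / 2) := by
    have := Gamma_pos_of_pos (half_pos hN')
    positivity
  have hK : 0 < (N : ℝ) / (2 - α) := by positivity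
  have g1 := Gamma_pos_of_pos hK
  have g2 := Gamma_pos_of_pos (add_pos hK hK)
  rw [Srad, CM]
  rw [show 2 * (N : ℝ) / (2 - α) / 2 = N / (2 - α) by ring,
    show 2 * (N : ℝ) / (2 - α) = N / (2 - α) + N / (2 - α) by ring,
    show 4 / ((N : ℝ) / (2 - α) + N / (2 - α)) = (4 - 2 * α) / N by field_simp; ring]
  generalize 2 * π ^ ((N : ℝ) / 2) / Gamma ((N : ℝ) / 2) = ω at hω
  generalize Gamma ((N : ℝ) / (2 - α)) = G at g1
  generalize Gamma ((N : ℝ) / (2 - α) + N / (2 - α)) = H at g2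
  have hb : ω / (2 - α) * (G * G / H) = (((2 - α) / 2)⁻¹ * ω) * (G ^ 2 / (2 * H)) := by
    field_simp
  rw [hb, mul_rpow (by positivity) (by positivity), mul_rpow (by positivity) (by positivity),
    inv_rpow (by positivity), rpow_sub (by positivity)]
  have h4 : ((2 - α) / 2) ^ (4 : ℝ) = ((2 - α) / 2) ^ 4 := by norm_cast
  rw [h4]
  have hp : 0 < ((2 - α) / 2) ^ ((4 - 2 * α) / N) := by positivity
  generalize ((2 - α) / 2) ^ ((4 - 2 * α) / N) = P at hp
  field_simp
  ring

/-- the extremal function `U_{1,α}` achieves equality in the radial inequality,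
with both integrals finite. -/
theorem stmt4 (N : ℕ) (hN : 2 ≤ N) (α : ℝ) (hα1 : ((4 : ℝ) - N)/2 < α) (hα2 : α < 2) :
    Integrable (fun x : EuclideanSpace ℝ (Fin N) => (wOp α (Usol N α 1) x)^2) ∧
    Integrable (fun x : EuclideanSpace ℝ (Fin N) => (Usol N α 1 x) ^ (pexp N α)) ∧
    (∫ x, (wOp α (Usol N α 1) x)^2)
      = Srad N α * (∫ x, (Usol N α 1 x) ^ (pexp N α)) ^ (((N : ℝ) - 4 + 2*α)/(N : ℝ)) := by
  have hN0 : N ≠ 0 := by omega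
  have hN' : 0 < (N : ℝ) := by exact_mod_cast Nat.pos_of_ne_zero hN0
  have hγ : 0 < 2 - α := by linarith
  have ha : 0 < (N : ℝ) - 4 + 2 * α := by linarith
  have hK : 2 < (N : ℝ) / (2 - α) := by
    rw [lt_div_iff₀ hγ]
    linarith
  have hD : 0 < ((N : ℝ) - 4 + 2*α) * ((N : ℝ) - 2 + α) * (N : ℝ) * ((N : ℝ) + 2 - α) :=
    mul_pos (mul_pos (mul_pos ha (by linarith)) hN') (by linarith)
  have hC : 0 < Cconst N α := rpow_pos_of_pos hD _
  have hG := Gamma_pos_of_pos (show 0 < (N : ℝ) / (2 - α) by positivity)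
  have hG2 := Gamma_pos_of_pos (show 0 < (N : ℝ) / (2 - α) + N / (2 - α) by positivity)
  have hω : 0 < 2 * π ^ ((N : ℝ) / 2) / Gamma ((N : ℝ) / 2) := by
    have := Gamma_pos_of_pos (half_pos hN')
    positivity
  obtain ⟨iE, vE⟩ := integrableOn_and_integral_extremal_energy hK
  obtain ⟨iP, vP⟩ := integrableOn_and_integral_beta_Ioi (a := (N : ℝ) / (2 - α))
    (b := N / (2 - α)) (by positivity) (by positivity)
  obtain ⟨iE', vE'⟩ := integrable_and_integral_norm_rpow hN0 hγ
    (F := fun t => ((1 + t) ^ (-((N : ℝ) / (2 - α))) * (N / (2 - α) + t)) ^ 2) iE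
  obtain ⟨iP', vP'⟩ := integrable_and_integral_norm_rpow hN0 hγ
    (F := fun t => (1 + t) ^ (-((N : ℝ) / (2 - α) + N / (2 - α)))) iP
  rw [vE] at vE'
  rw [vP] at vP'
  have hw : (fun x : EuclideanSpace ℝ (Fin N) => (wOp α (Usol N α 1) x) ^ 2) =ᵐ[volume]
      fun x => (Cconst N α * (N - 4 + 2 * α) * (2 - α)) ^ 2 *
      ((1 + ‖x‖ ^ (2 - α)) ^ (-((N : ℝ) / (2 - α))) * (N / (2 - α) + ‖x‖ ^ (2 - α))) ^ 2 := by
    have : Nonempty (Fin N) := ⟨⟨0, by omega⟩⟩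
    filter_upwards [Measure.ae_ne volume (0 : EuclideanSpace ℝ (Fin N))] with x hx
    rw [wOp_Usol_one hα2 hx]
    ring
  have hu : (fun x : EuclideanSpace ℝ (Fin N) => (Usol N α 1 x) ^ (pexp N α)) =
      fun x => Cconst N α ^ pexp N α *
        (1 + ‖x‖ ^ (2 - α)) ^ (-((N : ℝ) / (2 - α) + N / (2 - α))) := by
    ext x
    have : 0 ≤ 1 + ‖x‖ ^ (2 - α) := by positivity
    simp only [Usol, one_rpow, mul_one, one_mul]
    rw [mul_rpow hC.le (by positivity), ← rpow_mul this]
    congr 2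
    rw [pexp]
    field_simp
    ring
  refine ⟨(integrable_congr hw).2 (iE'.const_mul _), hu ▸ iP'.const_mul _, ?_⟩
  rw [integral_congr_ae hw, hu, integral_const_mul, integral_const_mul, vE', vP',
    Srad_eq hN0 hα2]
  have hCp : (Cconst N α ^ pexp N α) ^ (((N : ℝ) - 4 + 2 * α) / N) = Cconst N α ^ 2 := by
    rw [← rpow_mul hC.le, ← rpow_natCast, pexp]
    congr 1
    push_cast
    field_simp
  have hA : 0 < Gamma ((N : ℝ) / (2 - α)) * Gamma (N / (2 - α)) /
    Gamma (N / (2 - α) + N / (2 - α)) := by positivity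
  generalize 2 * π ^ ((N : ℝ) / 2) / Gamma ((N : ℝ) / 2) = ω at hω
  generalize Gamma ((N : ℝ) / (2 - α)) * Gamma (N / (2 - α)) /
    Gamma (N / (2 - α) + N / (2 - α)) = A at hA
  have hX : 0 < ω / (2 - α) * A := by positivity
  have hXX : (ω / (2 - α) * A) ^ ((4 - 2 * α) / N) *
      (ω / (2 - α) * A) ^ (((N : ℝ) - 4 + 2 * α) / N) = ω / (2 - α) * A := by
    rw [← rpow_add hX, show (4 - 2 * α) / N + ((N : ℝ) - 4 + 2 * α) / N = 1 by field_simp; ring,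
      rpow_one]
  rw [mul_rpow (rpow_nonneg hC.le _) hX.le, hCp, mul_mul_mul_comm, hXX]
  have hK2 : (N : ℝ) / (2 - α) - 2 = (N - 4 + 2 * α) / (2 - α) := by
    field_simp
    ring
  rw [hK2]
  field_simp
  ring

end
end

section
/- Let M > 4 be a real number and let V(s) = (1+s²)^{−(M−4)/2} for s > 0. Then the one-dimensional weighted integrals satisfy ∫₀^∞ [V''(s) + ((M−1)/s) V'(s)]² s^{M−1} ds = (M−4)(M−2)M(M+2) (Γ(M/2)²/(2Γ(M)))^{4/M} · (∫₀^∞ V(s)^{2M/(M−4)} s^{M−1} ds)^{(M−4)/M}, and both integrals are finite; i.e., V realizes the value C(M) = (M−4)(M−2)M(M+2)(Γ(M/2)²/(2Γ(M)))^{4/M} of the radial second-order Rayleigh quotient in dimension parameter M. -/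
open Real MeasureTheory Filter

noncomputable section

/-- Euler's Beta integral over the reals, as an integral on `(0, 1)`. -/
theorem integrableOn_and_integral_rpow_mul_one_sub_rpow {p q : ℝ} (hp : 0 < p) (hq : 0 < q) :
    IntegrableOn (fun x : ℝ => x ^ (p - 1) * (1 - x) ^ (q - 1)) (Set.Ioo 0 1) ∧
    ∫ x in Set.Ioo (0 : ℝ) 1, x ^ (p - 1) * (1 - x) ^ (q - 1)
      = Gamma p * Gamma q / Gamma (p + q) := by
  have hEq : Set.EqOn (fun x : ℝ => (x : ℂ) ^ ((p : ℂ) - 1) * (1 - (x : ℂ)) ^ ((q : ℂ) - 1))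
      (fun x : ℝ => ((x ^ (p - 1) * (1 - x) ^ (q - 1) : ℝ) : ℂ)) (Set.Ioo 0 1) := by
    intro x hx
    have h1 : (0 : ℝ) ≤ 1 - x := by linarith [hx.2]
    simp only [Complex.ofReal_mul, Complex.ofReal_cpow hx.1.le, Complex.ofReal_cpow h1,
      Complex.ofReal_sub, Complex.ofReal_one]
  have hconv := Complex.betaIntegral_convergent (u := p) (v := q) (by simpa) (by simpa)
  rw [intervalIntegrable_iff_integrableOn_Ioo_of_le zero_le_one,
    integrableOn_congr_fun hEq measurableSet_Ioo] at hconv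
  refine ⟨by simpa [IntegrableOn] using hconv.re, ?_⟩
  have hval := Complex.betaIntegral_eq_Gamma_mul_div p q (by simpa) (by simpa)
  rw [Complex.betaIntegral, intervalIntegral.integral_of_le zero_le_one,
    integral_Ioc_eq_integral_Ioo, setIntegral_congr_fun measurableSet_Ioo hEq,
    integral_complex_ofReal, ← Complex.ofReal_add] at hval
  simp only [Complex.Gamma_ofReal] at hval
  exact_mod_cast hval

theorem image_sq_div_one_add_sq_Ioi :
    (fun s : ℝ => s ^ 2 / (1 + s ^ 2)) '' Set.Ioi 0 = Set.Ioo 0 1 := by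
  ext x
  constructor
  · rintro ⟨s, hs, rfl⟩
    have hs' : 0 < s := hs
    exact ⟨by positivity, by rw [div_lt_one (by positivity)]; linarith⟩
  · rintro ⟨h0, h1⟩
    have h1' : 0 < 1 - x := by linarith
    refine ⟨√(x / (1 - x)), Real.sqrt_pos.2 (by positivity), ?_⟩
    simp only
    rw [Real.sq_sqrt (by positivity)]
    field_simp
    ring

theorem injOn_sq_div_one_add_sq_Ioi :
    Set.InjOn (fun s : ℝ => s ^ 2 / (1 + s ^ 2)) (Set.Ioi 0) := by
  intro a ha b hb hab
  have ha' : 0 < a := ha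
  have hb' : 0 < b := hb
  simp only at hab
  rw [div_eq_div_iff (by positivity) (by positivity)] at hab
  exact (pow_left_inj₀ ha'.le hb'.le two_ne_zero).1 (by linarith)

/-- The Beta integral on the half-line, after the substitution `x = s² / (1 + s²)`. -/
theorem integrableOn_and_integral_rpow_mul_one_add_sq_rpow {p q : ℝ} (hp : 0 < p) (hq : 0 < q) :
    IntegrableOn (fun s : ℝ => s ^ (2 * p - 1) * (1 + s ^ 2) ^ (-(p + q))) (Set.Ioi 0) ∧
    ∫ s in Set.Ioi (0 : ℝ), s ^ (2 * p - 1) * (1 + s ^ 2) ^ (-(p + q))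
      = Gamma p * Gamma q / (2 * Gamma (p + q)) := by
  have hderiv : ∀ s ∈ Set.Ioi (0 : ℝ), HasDerivWithinAt (fun s : ℝ => s ^ 2 / (1 + s ^ 2))
      (2 * s / (1 + s ^ 2) ^ 2) (Set.Ioi 0) s := by
    intro s _
    have h2 : HasDerivAt (fun s : ℝ => s ^ 2) (2 * s) s := by simpa using hasDerivAt_pow 2 s
    refine ((h2.div (h2.const_add 1) (by positivity)).congr_deriv ?_).hasDerivWithinAt
    congr 1
    ring
  have hEq : Set.EqOn (fun s : ℝ => |2 * s / (1 + s ^ 2) ^ 2| •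
        ((s ^ 2 / (1 + s ^ 2)) ^ (p - 1) * (1 - s ^ 2 / (1 + s ^ 2)) ^ (q - 1)))
      (fun s : ℝ => 2 * (s ^ (2 * p - 1) * (1 + s ^ 2) ^ (-(p + q)))) (Set.Ioi 0) := by
    intro s hs
    have hs' : 0 < s := hs
    have hw : 0 < 1 + s ^ 2 := by positivity
    have h1 : 1 - s ^ 2 / (1 + s ^ 2) = (1 + s ^ 2)⁻¹ := by field_simp; ring
    have e1 : (s ^ 2) ^ (p - 1) = s ^ (2 * p - 1) / s := by
      rw [← Real.rpow_natCast, ← Real.rpow_mul hs'.le, ← Real.rpow_sub_one hs'.ne']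
      congr 1
      push_cast
      ring
    have e2 : (1 + s ^ 2) ^ (-(p + q)) * (1 + s ^ 2) ^ 2
        = ((1 + s ^ 2) ^ (p - 1))⁻¹ * ((1 + s ^ 2) ^ (q - 1))⁻¹ := by
      rw [← Real.rpow_neg hw.le, ← Real.rpow_neg hw.le, ← Real.rpow_add hw,
        ← Real.rpow_natCast (1 + s ^ 2), ← Real.rpow_add hw]
      congr 1
      push_cast
      ring
    simp only [smul_eq_mul]
    rw [abs_of_pos (by positivity), h1, Real.div_rpow (by positivity) hw.le,
      Real.inv_rpow hw.le, e1]
    calc 2 * s / (1 + s ^ 2) ^ 2 * (s ^ (2 * p - 1) / s / (1 + s ^ 2) ^ (p - 1)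
            * ((1 + s ^ 2) ^ (q - 1))⁻¹)
        = 2 * s ^ (2 * p - 1) / (1 + s ^ 2) ^ 2
            * (((1 + s ^ 2) ^ (p - 1))⁻¹ * ((1 + s ^ 2) ^ (q - 1))⁻¹) := by
          field_simp
      _ = _ := by
          rw [← e2]
          field_simp
  obtain ⟨hInt, hval⟩ := integrableOn_and_integral_rpow_mul_one_sub_rpow hp hq
  rw [← image_sq_div_one_add_sq_Ioi] at hInt hval
  rw [integrableOn_image_iff_integrableOn_abs_deriv_smul measurableSet_Ioi hderiv
    injOn_sq_div_one_add_sq_Ioi, integrableOn_congr_fun hEq measurableSet_Ioi] at hInt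
  rw [integral_image_eq_integral_abs_deriv_smul measurableSet_Ioi hderiv
    injOn_sq_div_one_add_sq_Ioi, setIntegral_congr_fun measurableSet_Ioi hEq,
    integral_const_mul] at hval
  refine ⟨?_, ?_⟩
  · have h := hInt.const_mul (1 / 2)
    refine h.congr (Eventually.of_forall fun s => ?_)
    simp only
    ring
  · rw [mul_comm 2 (Gamma (p + q)), ← div_div, ← hval]
    ring

theorem hasDerivAt_one_add_sq_rpow (k s : ℝ) :
    HasDerivAt (fun s : ℝ => (1 + s ^ 2) ^ k) (2 * k * s * (1 + s ^ 2) ^ (k - 1)) s := by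
  have h2 : HasDerivAt (fun s : ℝ => 1 + s ^ 2) (2 * s) s := by
    simpa using (hasDerivAt_pow 2 s).const_add 1
  exact (h2.rpow_const (p := k) (Or.inl (by positivity))).congr_deriv (by ring)

theorem deriv_deriv_one_add_sq_rpow (k s : ℝ) :
    deriv (deriv fun s : ℝ => (1 + s ^ 2) ^ k) s
      = 2 * k * (1 + s ^ 2) ^ (k - 1)
        + 4 * k * (k - 1) * s ^ 2 * (1 + s ^ 2) ^ (k - 1 - 1) := by
  have h1 : (deriv fun s : ℝ => (1 + s ^ 2) ^ k)
      = fun s => 2 * k * s * (1 + s ^ 2) ^ (k - 1) :=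
    funext fun s => (hasDerivAt_one_add_sq_rpow k s).deriv
  rw [h1]
  refine HasDerivAt.deriv ?_
  refine (((hasDerivAt_id' s).const_mul (2 * k)).mul
    (hasDerivAt_one_add_sq_rpow (k - 1) s)).congr_deriv ?_
  ring

/-- The radial Laplacian in dimension parameter `M` of `(1 + s²) ^ (-(M - 4) / 2)`. -/
theorem radial_laplacian_one_add_sq_rpow (M : ℝ) {s : ℝ} (hs : s ≠ 0) :
    deriv (deriv fun s : ℝ => (1 + s ^ 2) ^ (-((M - 4) / 2))) s
        + (M - 1) / s * deriv (fun s : ℝ => (1 + s ^ 2) ^ (-((M - 4) / 2))) s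
      = -((M - 4) * (M + 2 * s ^ 2) * (1 + s ^ 2) ^ (-(M / 2))) := by
  have hw : 0 < 1 + s ^ 2 := by positivity
  rw [deriv_deriv_one_add_sq_rpow, (hasDerivAt_one_add_sq_rpow _ s).deriv]
  have e1 : -((M - 4) / 2) - 1 = -(M / 2) + 1 := by ring
  have e2 : -((M - 4) / 2) - 1 - 1 = -(M / 2) := by ring
  rw [e2, e1, Real.rpow_add_one hw.ne']
  field_simp
  ring

theorem sq_radial_laplacian_mul_rpow (M : ℝ) {s : ℝ} (hs : 0 < s) :
    (deriv (deriv fun s : ℝ => (1 + s ^ 2) ^ (-((M - 4) / 2))) s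
        + (M - 1) / s * deriv (fun s : ℝ => (1 + s ^ 2) ^ (-((M - 4) / 2))) s) ^ 2 * s ^ (M - 1)
      = (M - 4) ^ 2 * M ^ 2 * (s ^ (2 * (M / 2) - 1) * (1 + s ^ 2) ^ (-(M / 2 + M / 2)))
        + 4 * (M - 4) ^ 2 * M *
          (s ^ (2 * (M / 2 + 1) - 1) * (1 + s ^ 2) ^ (-((M / 2 + 1) + (M / 2 - 1))))
        + 4 * (M - 4) ^ 2 *
          (s ^ (2 * (M / 2 + 2) - 1) * (1 + s ^ 2) ^ (-((M / 2 + 2) + (M / 2 - 2)))) := by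
  have hw : 0 < 1 + s ^ 2 := by positivity
  have a0 : -(M / 2 + M / 2) = -(M / 2) + -(M / 2) := by ring
  have a1 : -((M / 2 + 1) + (M / 2 - 1)) = -(M / 2) + -(M / 2) := by ring
  have a2 : -((M / 2 + 2) + (M / 2 - 2)) = -(M / 2) + -(M / 2) := by ring
  have b0 : 2 * (M / 2) - 1 = M - 1 := by ring
  have b1 : 2 * (M / 2 + 1) - 1 = M - 1 + (2 : ℕ) := by push_cast; ring
  have b2 : 2 * (M / 2 + 2) - 1 = M - 1 + (4 : ℕ) := by push_cast; ring
  rw [radial_laplacian_one_add_sq_rpow M hs.ne', a0, a1, a2, b0, b1, b2, Real.rpow_add hw,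
    Real.rpow_add_natCast hs.ne', Real.rpow_add_natCast hs.ne']
  ring

/-- `V(s) = (1+s²)^{−(M−4)/2}` realizes the value `C(M)` of the radial second-order
Rayleigh quotient in dimension parameter `M`, and both weighted integrals are finite. -/
theorem stmt5 (M : ℝ) (hM : 4 < M) :
    let V : ℝ → ℝ := fun s => (1 + s^2) ^ (-((M-4)/2))
    IntegrableOn
      (fun s => (deriv (deriv V) s + (M-1)/s * deriv V s)^2 * s^(M-1)) (Set.Ioi 0) ∧
    IntegrableOn (fun s => (V s) ^ (2*M/(M-4)) * s^(M-1)) (Set.Ioi 0) ∧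
    (∫ s in Set.Ioi (0:ℝ), (deriv (deriv V) s + (M-1)/s * deriv V s)^2 * s^(M-1))
      = CM M * (∫ s in Set.Ioi (0:ℝ), (V s) ^ (2*M/(M-4)) * s^(M-1)) ^ ((M-4)/M) := by
  intro V
  have hM4 : M - 4 ≠ 0 := by linarith
  have hV : Set.EqOn (fun s => (V s) ^ (2*M/(M-4)) * s^(M-1))
      (fun s => s ^ (2 * (M / 2) - 1) * (1 + s ^ 2) ^ (-(M / 2 + M / 2))) (Set.Ioi 0) := by
    intro s _
    have e : -((M - 4) / 2) * (2 * M / (M - 4)) = -(M / 2 + M / 2) := by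
      field_simp
      ring
    simp only [V]
    rw [← Real.rpow_mul (by positivity), e, mul_comm, mul_div_cancel₀ M two_ne_zero]
  have hL : Set.EqOn (fun s => (deriv (deriv V) s + (M-1)/s * deriv V s)^2 * s^(M-1)) _
      (Set.Ioi 0) := fun s hs => sq_radial_laplacian_mul_rpow M hs
  obtain ⟨i0, v0⟩ := integrableOn_and_integral_rpow_mul_one_add_sq_rpow
    (p := M / 2) (q := M / 2) (by linarith) (by linarith)
  obtain ⟨i1, v1⟩ := integrableOn_and_integral_rpow_mul_one_add_sq_rpow
    (p := M / 2 + 1) (q := M / 2 - 1) (by linarith) (by linarith)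
  obtain ⟨i2, v2⟩ := integrableOn_and_integral_rpow_mul_one_add_sq_rpow
    (p := M / 2 + 2) (q := M / 2 - 2) (by linarith) (by linarith)
  have j0 := i0.const_mul ((M - 4) ^ 2 * M ^ 2)
  have j1 := i1.const_mul (4 * (M - 4) ^ 2 * M)
  have j2 := i2.const_mul (4 * (M - 4) ^ 2)
  rw [integrableOn_congr_fun hL measurableSet_Ioi, integrableOn_congr_fun hV measurableSet_Ioi,
    setIntegral_congr_fun measurableSet_Ioi hL, setIntegral_congr_fun measurableSet_Ioi hV]
  refine ⟨(j0.add j1).add j2, i0, ?_⟩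
  rw [integral_add (j0.fun_add j1) j2, integral_add j0 j1, integral_const_mul, integral_const_mul,
    integral_const_mul, v0, v1, v2]
  have c0 : M / 2 + M / 2 = M := by ring
  have c1 : M / 2 + 1 + (M / 2 - 1) = M := by ring
  have c2 : M / 2 + 2 + (M / 2 - 2) = M := by ring
  rw [c0, c1, c2]
  have hM0 : 0 < M := by linarith
  have hG : 0 < Gamma M := Gamma_pos_of_pos hM0
  have hG2 : 0 < Gamma (M / 2) := Gamma_pos_of_pos (by linarith)
  have hJ : 0 < Gamma (M / 2) ^ 2 / (2 * Gamma M) := by positivity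
  have g1 : Gamma (M / 2 + 1) = M / 2 * Gamma (M / 2) := Gamma_add_one (by linarith)
  have g2 : Gamma (M / 2 + 2) = (M / 2 + 1) * (M / 2 * Gamma (M / 2)) := by
    rw [← g1, ← Gamma_add_one (by linarith)]
    congr 1
    ring
  have g3 : Gamma (M / 2) = (M / 2 - 1) * Gamma (M / 2 - 1) := by
    rw [← Gamma_add_one (by linarith)]
    congr 1
    ring
  have g4 : Gamma (M / 2 - 1) = (M / 2 - 2) * Gamma (M / 2 - 2) := by
    rw [← Gamma_add_one (by linarith)]
    congr 1
    ring
  have hpow : (Gamma (M / 2) ^ 2 / (2 * Gamma M)) ^ (4 / M)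
      * (Gamma (M / 2) ^ 2 / (2 * Gamma M)) ^ ((M - 4) / M)
      = Gamma (M / 2) ^ 2 / (2 * Gamma M) := by
    rw [← Real.rpow_add hJ]
    convert Real.rpow_one _ using 2
    field_simp
    ring
  rw [CM, ← pow_two, mul_assoc (_ * (M + 2)), hpow, g1, g2, g3, g4]
  field_simp
  ring

end
end

section
/- Let N ≥ 2 be an integer and α a real number with (4−N)/2 < α < 2. Set q = (2−α)/2 and M = 2N/(2−α). Let u ∈ C_c^∞((0,∞)) and define v(s) = u(s^{1/q}) for s > 0. Then ∫₀^∞ [u''(r) + ((N+α−1)/r) u'(r)]² r^{N+2α−1} dr = q³ ∫₀^∞ [v''(s) + ((M−1)/s) v'(s)]² s^{M−1} ds. -/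
open Real MeasureTheory Filter

noncomputable section

/-- First derivative of `s ↦ f (s ^ p)` on the open half-line. -/
theorem hasDerivAt_comp_rpow {f : ℝ → ℝ} (hf : Differentiable ℝ f) (p : ℝ) {s : ℝ} (hs : 0 < s) :
    HasDerivAt (fun x => f (x ^ p)) (deriv f (s ^ p) * (p * s ^ (p - 1))) s :=
  (hf (s ^ p)).hasDerivAt.comp s (Real.hasDerivAt_rpow_const (Or.inl hs.ne'))

/-- Second derivative of `s ↦ f (s ^ p)` on the open half-line. -/
theorem deriv_deriv_comp_rpow {f : ℝ → ℝ} (hf : Differentiable ℝ f)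
    (hf' : Differentiable ℝ (deriv f)) (p : ℝ) {s : ℝ} (hs : 0 < s) :
    deriv (deriv fun x => f (x ^ p)) s =
      deriv (deriv f) (s ^ p) * (p * s ^ (p - 1)) * (p * s ^ (p - 1)) +
        deriv f (s ^ p) * (p * ((p - 1) * s ^ (p - 1 - 1))) := by
  have hloc : deriv (fun x => f (x ^ p)) =ᶠ[nhds s]
      fun x => deriv f (x ^ p) * (p * x ^ (p - 1)) := by
    filter_upwards [Ioi_mem_nhds hs] with x hx
    exact (hasDerivAt_comp_rpow hf p hx).deriv
  rw [hloc.deriv_eq]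
  exact ((hasDerivAt_comp_rpow hf' p hs).mul
    ((Real.hasDerivAt_rpow_const (Or.inl hs.ne')).const_mul p)).deriv

/-- the change of variables `r = s^{1/q}`, `q = (2−α)/2`, transforms the radial
weighted second-order energy in dimension `N` into `q³` times the radial bilaplacian energy in
dimension parameter `M = 2N/(2−α)`. -/
theorem stmt8 (N : ℕ) (hN : 2 ≤ N) (α : ℝ) (hα1 : ((4 : ℝ) - N)/2 < α) (hα2 : α < 2)
    (u : ℝ → ℝ) (hu : ContDiff ℝ (⊤ : ℕ∞) u) (hsupp : HasCompactSupport u)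
    (hpos : tsupport u ⊆ Set.Ioi 0) :
    let q : ℝ := (2-α)/2
    let M : ℝ := 2*(N : ℝ)/(2-α)
    let v : ℝ → ℝ := fun s => u (s ^ (1/q))
    (∫ r in Set.Ioi (0:ℝ),
        (deriv (deriv u) r + ((N : ℝ) + α - 1)/r * deriv u r)^2 * r^((N : ℝ) + 2*α - 1))
      = q^3 * ∫ s in Set.Ioi (0:ℝ),
          (deriv (deriv v) s + (M-1)/s * deriv v s)^2 * s^(M-1) := by
  intro q M v
  have hq : 0 < q := div_pos (by linarith) two_pos
  have hq0 := hq.ne'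
  have hp : 0 < 1 / q := one_div_pos.mpr hq
  have hα : α = 2 - 2 * q := by simp only [q]; ring
  have hM : M = N / q := by simp only [M, q]; field_simp
  have hu1 : Differentiable ℝ u := hu.differentiable (by simp)
  have hu2 : Differentiable ℝ (deriv u) :=
    ((contDiff_infty_iff_deriv.mp hu).2).differentiable (by simp)
  rw [← integral_comp_rpow_Ioi_of_pos hp, ← integral_const_mul]
  refine setIntegral_congr_fun measurableSet_Ioi fun s hs => ?_
  have hs : 0 < s := hs
  have hv1 : deriv v s = _ := (hasDerivAt_comp_rpow hu1 (1 / q) hs).deriv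
  have hv2 : deriv (deriv v) s = _ := deriv_deriv_comp_rpow hu1 hu2 (1 / q) hs
  have hr : 0 < s ^ (1 / q) := rpow_pos_of_pos hs _
  have hweight : (s ^ (1 / q)) ^ ((N : ℝ) + 2 * α - 1) =
      (s ^ (1 / q)) ^ 3 * s ^ (M - 1) / s ^ 3 := by
    rw [← rpow_natCast, ← rpow_natCast s, ← rpow_mul hs.le, ← rpow_mul hs.le, ← rpow_add hs,
      ← rpow_sub hs]
    congr 1
    rw [hM, hα]
    push_cast
    field_simp
    ring
  simp only [smul_eq_mul]
  rw [hv1, hv2, hweight, rpow_sub_one hs.ne' (1 / q - 1), rpow_sub_one hs.ne' (1 / q), hM, hα]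
  generalize s ^ (1 / q) = r at hr ⊢
  field_simp
  ring

end
end
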